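/- arXiv:2006.04789 — 2 statements merged into one kernel-verified Lean document; each statement's English description precedes it below -/
import Mathlib

section
/- Let R be a commutative noetherian ring with a multiplicative set S of non-zero-divisors, satisfying Assumption (⋆). Let 0 → M → P_1 → P_2 → N → 0 be an exact sequence of finitely generated S-torsion R-modules, all lying in 𝓒, with pd_R(P_1) ≤ 1 and pd_R(P_2) ≤ 1. Then, as fractional ideals of R with respect to S, Fitt_R(P_1)·Fitt_R(N) = Fitt_R(P_2)·Fitt_R(Ext^1_R(M, R)). Equivalently, the (-2)-nd shift of the quasi-Fitting invariant Fitt_R satisfies Fitt_R^⟨-2⟩(M) = Fitt_R(M^*) for every M ∈ 𝓒, where M^* = Ext^1_R(M, R). -/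
open CategoryTheory MulOpposite

noncomputable section

/-- `M` is `S`-torsion: every element is annihilated by some element of `S`. -/
def STorsion (R : Type) [Ring R] (S : Submonoid R) (M : Type) [AddCommGroup M] [Module R M] :
    Prop :=
  ∀ m : M, ∃ s ∈ S, s • m = 0

/-- Projective dimension `≤ n`, witnessed by resolutions with finite free stages. -/
def PdLE (R : Type) [Ring R] : ℕ → (M : Type) → [AddCommGroup M] → [Module R M] → Prop
  | 0, M, _, _ => Module.Projective R M
  | n+1, M, _, _ => ∃ (k : ℕ) (f : (Fin k → R) →ₗ[R] M),
      Function.Surjective f ∧ PdLE R n (LinearMap.ker f)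

/-- Finite projective dimension. -/
def FinitePd (R : Type) [Ring R] (M : Type) [AddCommGroup M] [Module R M] : Prop :=
  ∃ n, PdLE R n M

/-- Membership in the category `𝓜` of finitely generated `S`-torsion modules. -/
def MemM (R : Type) [Ring R] (S : Submonoid R) (M : Type) [AddCommGroup M] [Module R M] : Prop :=
  Module.Finite R M ∧ STorsion R S M

/-- Membership in `𝓟`: finitely generated `S`-torsion of projective dimension `≤ 1`. -/
def MemP (R : Type) [Ring R] (S : Submonoid R) (M : Type) [AddCommGroup M] [Module R M] : Prop :=
  MemM R S M ∧ PdLE R 1 M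

/-- Membership in `𝓠`: finitely generated `S`-torsion of finite projective dimension. -/
def MemQ (R : Type) [Ring R] (S : Submonoid R) (M : Type) [AddCommGroup M] [Module R M] : Prop :=
  MemM R S M ∧ FinitePd R M

/-- The Ext group `Ext^i_R(M, N)`. -/
abbrev extGroup (R : Type) [Ring R] (M N : Type) [AddCommGroup M] [Module R M]
    [AddCommGroup N] [Module R N] (i : ℕ) : Type :=
  (((_root_.Ext ℤ (ModuleCat R) i).obj (Opposite.op (ModuleCat.of R M))).obj (ModuleCat.of R N))

/-- Vanishing of `Ext^i_R(M, R)`. -/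
def ExtRVanish (R : Type) [Ring R] (M : Type) [AddCommGroup M] [Module R M] (i : ℕ) : Prop :=
  Subsingleton (extGroup R M R i)

/-- `pd*_R(M) ≤ 1`, i.e. `Ext^i_R(M, R) = 0` for all `i ≥ 2`. -/
def PdStarLE1 (R : Type) [Ring R] (M : Type) [AddCommGroup M] [Module R M] : Prop :=
  ∀ i, 2 ≤ i → ExtRVanish R M i

/-- Membership in `𝓒`: finitely generated `S`-torsion with `pd* ≤ 1`. -/
def MemC (R : Type) [Ring R] (S : Submonoid R) (M : Type) [AddCommGroup M] [Module R M] : Prop :=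
  MemM R S M ∧ PdStarLE1 R M

/-- Assumption (⋆): a uniform bound `d(R)` on `pd*` of all finitely generated left or
right `R`-modules. -/
def AssumptionStar (R : Type) [Ring R] : Prop :=
  ∃ d : ℕ,
    (∀ (M : Type) [AddCommGroup M] [Module R M], Module.Finite R M →
      ∀ i, d < i → ExtRVanish R M i) ∧
    (∀ (M : Type) [AddCommGroup M] [Module Rᵐᵒᵖ M], Module.Finite Rᵐᵒᵖ M →
      ∀ i, d < i → ExtRVanish Rᵐᵒᵖ M i)

/-- `S` is a (left and right) Ore set consisting of non-zero-divisors. -/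
def IsOreSet (R : Type) [Ring R] (S : Submonoid R) : Prop :=
  S ≤ nonZeroDivisors R ∧
    (∀ f ∈ S, ∀ a : R, ∃ r : R, ∃ s ∈ S, f * r = a * s) ∧
    (∀ f ∈ S, ∀ a : R, ∃ r : R, ∃ s ∈ S, r * f = s * a)

/-- A sequence of `R`-modules and maps, used to encode finite exact sequences. -/
structure ModSeq (R : Type) [Ring R] where
  C : ℕ → Type
  [acg : ∀ i, AddCommGroup (C i)]
  [mod : ∀ i, Module R (C i)]
  f : ∀ i, C i →ₗ[R] C (i+1)

attribute [instance] ModSeq.acg ModSeq.mod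

/-- `D.ExactTrunc n` : the window `0 → C 0 → C 1 → ⋯ → C (n+1) → 0` is exact. -/
def ModSeq.ExactTrunc {R : Type} [Ring R] (D : ModSeq R) (n : ℕ) : Prop :=
  Function.Injective (D.f 0) ∧ Function.Surjective (D.f n) ∧
    ∀ i < n, Function.Exact (D.f i) (D.f (i+1))

/-- The (initial) Fitting ideal of a module over a commutative ring. -/
def fittingIdeal (R : Type) [CommRing R] (M : Type) [AddCommGroup M] [Module R M] : Ideal R :=
  Ideal.span { x : R | ∃ (a : ℕ) (A : Matrix (Fin a) (Fin a) R) (π : (Fin a → R) →ₗ[R] M),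
    Function.Surjective π ∧ (∀ j, π (fun i => A i j) = 0) ∧ x = A.det }

/-- The Fitting ideal viewed as a fractional ideal, i.e. a finitely generated
`R`-submodule of `S⁻¹R`. -/
def fittFrac (R : Type) [CommRing R] (S : Submonoid R) (M : Type) [AddCommGroup M]
    [Module R M] : Submodule R (Localization S) :=
  Submodule.map (Algebra.linearMap R (Localization S)) (fittingIdeal R M)

/-- Precomposition with `ι`, as a map of right `R`-modules `Hom(F, R) → Hom(N, R)`. -/
def precompDual (R : Type) [Ring R] {N F : Type} [AddCommGroup N] [Module R N]
    [AddCommGroup F] [Module R F] (ι : N →ₗ[R] F) :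
    (F →ₗ[R] R) →ₗ[Rᵐᵒᵖ] (N →ₗ[R] R) where
  toFun g := g.comp ι
  map_add' _ _ := LinearMap.ext fun _ => rfl
  map_smul' _ _ := LinearMap.ext fun _ => rfl

/-- `Ext^1_R(M, R)` computed from a presentation `0 → N → F → M → 0` with `F` projective:
the cokernel of `Hom(F, R) → Hom(N, R)`; it is a right `R`-module. -/
abbrev ExtOneDual (R : Type) [Ring R] {N F : Type} [AddCommGroup N] [Module R N]
    [AddCommGroup F] [Module R F] (ι : N →ₗ[R] F) : Type :=
  (N →ₗ[R] R) ⧸ LinearMap.range (precompDual R ι)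

/-- Precomposition with `ι`, commutative case. -/
def precompDualComm (R : Type) [CommRing R] {N F : Type} [AddCommGroup N] [Module R N]
    [AddCommGroup F] [Module R F] (ι : N →ₗ[R] F) :
    (F →ₗ[R] R) →ₗ[R] (N →ₗ[R] R) where
  toFun g := g.comp ι
  map_add' _ _ := LinearMap.ext fun _ => rfl
  map_smul' _ _ := LinearMap.ext fun _ => rfl

/-- `Ext^1_R(M, R)` computed from a presentation, commutative case. -/
abbrev ExtOneDualComm (R : Type) [CommRing R] {N F : Type} [AddCommGroup N] [Module R N]
    [AddCommGroup F] [Module R F] (ι : N →ₗ[R] F) : Type :=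
  (N →ₗ[R] R) ⧸ LinearMap.range (precompDualComm R ι)

/-- A Fitting invariant `𝓕 : 𝓜 → Ω`. -/
def IsFittingInv (R : Type) [Ring R] (S : Submonoid R) {Ω : Type} [CommMonoid Ω]
    (F : (M : Type) → [AddCommGroup M] → [Module R M] → Ω) : Prop :=
  (∀ (P : Type) [AddCommGroup P] [Module R P], MemP R S P → IsUnit (F P)) ∧
  (∀ (M' M P : Type) [AddCommGroup M'] [Module R M'] [AddCommGroup M] [Module R M]
      [AddCommGroup P] [Module R P], MemM R S M' → MemM R S M → MemP R S P →
    ∀ (ι : M' →ₗ[R] M) (p : M →ₗ[R] P), Function.Injective ι → Function.Surjective p →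
      Function.Exact ι p → F M = F P * F M')

/-- A quasi-Fitting invariant `𝓕 : 𝓒 → Ω`. -/
def IsQuasiFittingInv (R : Type) [Ring R] (S : Submonoid R) {Ω : Type} [CommMonoid Ω]
    (F : (M : Type) → [AddCommGroup M] → [Module R M] → Ω) : Prop :=
  (∀ (P : Type) [AddCommGroup P] [Module R P], MemP R S P → IsUnit (F P)) ∧
  (∀ (M' M P : Type) [AddCommGroup M'] [Module R M'] [AddCommGroup M] [Module R M]
      [AddCommGroup P] [Module R P], MemC R S M' → MemC R S M → MemP R S P →
    ∀ (ι : M' →ₗ[R] M) (p : M →ₗ[R] P), Function.Injective ι → Function.Surjective p →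
      Function.Exact ι p → F M = F P * F M') ∧
  (∀ (P M M' : Type) [AddCommGroup P] [Module R P] [AddCommGroup M] [Module R M]
      [AddCommGroup M'] [Module R M'], MemP R S P → MemC R S M → MemC R S M' →
    ∀ (ι : P →ₗ[R] M) (p : M →ₗ[R] M'), Function.Injective ι → Function.Surjective p →
      Function.Exact ι p → F M = F P * F M')

/-- The membership predicate of `𝓜` as a family. -/
def MemMFam (R : Type) [Ring R] (S : Submonoid R) (M : Type) [AddCommGroup M] [Module R M] :
    Prop :=
  MemM R S M

/-- The membership predicate of `𝓒` as a family. -/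
def MemCFam (R : Type) [Ring R] (S : Submonoid R) (M : Type) [AddCommGroup M] [Module R M] :
    Prop :=
  MemC R S M

/-- `ω` is the value obtained from an exact sequence `0 → N → P₁ → ⋯ → Pₙ → M → 0`
(`n ≥ 0`), with all terms satisfying `Mem`, each `Pᵢ ∈ 𝓟`, via the formula
`ω = (∏ i, 𝓕(Pᵢ)^((-1)^i)) · 𝓕(N)`; inverses are recorded by witnesses `u`. -/
def PosShiftValue (R : Type) [Ring R] (S : Submonoid R) {Ω : Type} [CommMonoid Ω]
    (Mem : (M : Type) → [AddCommGroup M] → [Module R M] → Prop)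
    (F : (M : Type) → [AddCommGroup M] → [Module R M] → Ω) (n : ℕ)
    (M : Type) [AddCommGroup M] [Module R M] (ω : Ω) : Prop :=
  ∃ D : ModSeq R, D.ExactTrunc n ∧ Nonempty (D.C (n+1) ≃ₗ[R] M) ∧
    (∀ i, i ≤ n+1 → Mem (D.C i)) ∧ (∀ i, 1 ≤ i → i ≤ n → MemP R S (D.C i)) ∧
    ∃ u : ℕ → Ω, (∀ i, 1 ≤ i → i ≤ n → F (D.C i) * u i = 1) ∧
      ω = (∏ i ∈ Finset.range n, if (i+1) % 2 = 1 then u (i+1) else F (D.C (i+1))) * F (D.C 0)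

/-- `ω` is the value obtained from an exact sequence `0 → M → P_m → ⋯ → P₁ → N → 0`
(`m ≥ 1` corresponding to the shift `n = -m < 0`) via the formula
`ω = (∏ i, 𝓕(Pᵢ)^((-1)^i)) · 𝓕(N)`. -/
def NegShiftValue (R : Type) [Ring R] (S : Submonoid R) {Ω : Type} [CommMonoid Ω]
    (Mem : (M : Type) → [AddCommGroup M] → [Module R M] → Prop)
    (F : (M : Type) → [AddCommGroup M] → [Module R M] → Ω) (m : ℕ)
    (M : Type) [AddCommGroup M] [Module R M] (ω : Ω) : Prop :=
  ∃ D : ModSeq R, D.ExactTrunc m ∧ Nonempty (D.C 0 ≃ₗ[R] M) ∧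
    (∀ i, i ≤ m+1 → Mem (D.C i)) ∧ (∀ i, 1 ≤ i → i ≤ m → MemP R S (D.C i)) ∧
    ∃ u : ℕ → Ω, (∀ i, 1 ≤ i → i ≤ m → F (D.C i) * u i = 1) ∧
      ω = (∏ i ∈ Finset.range m, if (i+1) % 2 = 1 then u (m-i) else F (D.C (m-i))) * F (D.C (m+1))

/-- `ω` is the value of the `n`-th shift (`n ∈ ℤ`) of `F` at `M` computed from some
admissible exact sequence whose terms satisfy `Mem`. -/
def ShiftValue (R : Type) [Ring R] (S : Submonoid R) {Ω : Type} [CommMonoid Ω]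
    (Mem : (M : Type) → [AddCommGroup M] → [Module R M] → Prop)
    (F : (M : Type) → [AddCommGroup M] → [Module R M] → Ω) (n : ℤ)
    (M : Type) [AddCommGroup M] [Module R M] (ω : Ω) : Prop :=
  if 0 ≤ n then PosShiftValue R S Mem F n.toNat M ω else NegShiftValue R S Mem F (-n).toNat M ω

/-- The axioms for the family of shifts `{𝓕⁽ⁿ⁾ : 𝓜 → Ω}` of a quasi-Fitting invariant. -/
def IsShiftFamily (R : Type) [Ring R] (S : Submonoid R) {Ω : Type} [CommMonoid Ω]
    (F : (M : Type) → [AddCommGroup M] → [Module R M] → Ω)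
    (G : ℤ → (M : Type) → [AddCommGroup M] → [Module R M] → Ω) : Prop :=
  (∀ (M : Type) [AddCommGroup M] [Module R M], MemC R S M → G 0 M = F M) ∧
  (∀ (n : ℤ) (P : Type) [AddCommGroup P] [Module R P], MemQ R S P → IsUnit (G n P)) ∧
  (∀ (n : ℤ) (N P M : Type) [AddCommGroup N] [Module R N] [AddCommGroup P] [Module R P]
      [AddCommGroup M] [Module R M], MemM R S N → MemQ R S P → MemM R S M →
    ∀ (ι : N →ₗ[R] P) (p : P →ₗ[R] M), Function.Injective ι → Function.Surjective p →
      Function.Exact ι p → G n M = G n P * G (n-1) N) ∧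
  (∀ (n : ℤ) (M' M P : Type) [AddCommGroup M'] [Module R M'] [AddCommGroup M] [Module R M]
      [AddCommGroup P] [Module R P], MemM R S M' → MemM R S M → MemQ R S P →
    ∀ (ι : M' →ₗ[R] M) (p : M →ₗ[R] P), Function.Injective ι → Function.Surjective p →
      Function.Exact ι p → G n M = G n P * G n M') ∧
  (∀ (n : ℤ) (P M M' : Type) [AddCommGroup P] [Module R P] [AddCommGroup M] [Module R M]
      [AddCommGroup M'] [Module R M'], MemQ R S P → MemM R S M → MemM R S M' →
    ∀ (ι : P →ₗ[R] M) (p : M →ₗ[R] M'), Function.Injective ι → Function.Surjective p →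
      Function.Exact ι p → G n M = G n P * G n M')

end

theorem Sum.elim_update_comp_symm {α β κ γ : Type*} [DecidableEq α] [DecidableEq κ]
    (e : α ⊕ β ≃ κ) (v : α → γ) (U : β → γ) (i : α) (x : γ) :
    (fun k => Sum.elim (Function.update v i x) U (e.symm k))
      = Function.update (fun k => Sum.elim v U (e.symm k)) (e (Sum.inl i)) x := by
  ext k
  obtain ⟨k | k, rfl⟩ := e.surjective k <;> simp [Function.update_apply]

/-- The determinant of a square matrix as an alternating function of `p` of its rows, the other
rows being fixed; `e` records which rows are which. -/
noncomputable def detRows {T : Type*} [CommRing T] {p : ℕ} {α κ : Type*} [Fintype κ] [DecidableEq κ]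
    [DecidableEq α] (e : Fin p ⊕ α ≃ κ) (U : α → κ → T) : (κ → T) [⋀^Fin p]→ₗ[T] T where
  toFun v := Matrix.detRowAlternating fun k => Sum.elim v U (e.symm k)
  map_update_add' {inst} v i x y := by
    obtain rfl : inst = instDecidableEqFin p := Subsingleton.elim _ _
    simp only [Sum.elim_update_comp_symm, AlternatingMap.map_update_add]
  map_update_smul' {inst} v i c x := by
    obtain rfl : inst = instDecidableEqFin p := Subsingleton.elim _ _
    simp only [Sum.elim_update_comp_symm, AlternatingMap.map_update_smul]
  map_eq_zero_of_eq' v i j hv hij :=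
    AlternatingMap.map_eq_zero_of_eq _ _ (i := e (Sum.inl i)) (j := e (Sum.inl j))
      (by simpa using! hv) (by simpa using hij)

/-- An alternating form lies in any span containing the products of minors with its values on
standard basis vectors. -/
theorem AlternatingMap.apply_mem_mul {R T : Type*} [CommRing R] [CommRing T] [Algebra R T] {p : ℕ}
    {κ : Type*} [Finite κ] [DecidableEq κ] (f : (κ → T) [⋀^Fin p]→ₗ[T] T) (v : Fin p → κ → T)
    (D J : Submodule R T)
    (hD : ∀ I : Fin p → κ, (Matrix.of fun i j => v i (I j)).det ∈ D)
    (hJ : ∀ I : Fin p → κ, f (fun j => Pi.single (I j) 1) ∈ J) : f v ∈ D * J := by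
  classical
  let _ : LinearOrder κ := linearOrderOfSTO WellOrderingRel
  have := Fintype.ofFinite κ
  have h1 : f v = exteriorPower.alternatingMapLinearEquiv f (exteriorPower.ιMulti T p v) := by simp
  rw [h1, ← ((Pi.basisFun T κ).exteriorPower p).sum_repr (exteriorPower.ιMulti T p v), map_sum]
  refine Submodule.sum_mem _ fun s _ => ?_
  rw [map_smul, smul_eq_mul, exteriorPower.basis_repr_apply,
    exteriorPower.ιMultiDual_apply_ιMulti]
  refine Submodule.mul_mem_mul (by simpa using hD _) ?_
  rw [exteriorPower.basis_apply, exteriorPower.ιMulti_family,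
    exteriorPower.alternatingMapLinearEquiv_apply_ιMulti]
  convert hJ (Set.powersetCard.ofFinEmbEquiv.symm s) with j
  ext k
  simp [Pi.single_apply, Pi.basisFun_apply]

/-- If all rows except `p` of them have entries in `R`, the determinant is an `R`-combination of
the maximal minors of these `p` rows. -/
theorem Matrix.det_mem_of_rows {R T : Type*} [CommRing R] [CommRing T] [Algebra R T] {p : ℕ}
    {α κ : Type*} [Fintype κ] [DecidableEq κ] [DecidableEq α] (e : Fin p ⊕ α ≃ κ)
    (Z : Matrix κ κ T) (D : Submodule R T)
    (hD : ∀ I : Fin p → κ, (Matrix.of fun i j => Z (e (Sum.inl i)) (I j)).det ∈ D)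
    (hZ : ∀ a k, Z (e (Sum.inr a)) k ∈ (algebraMap R T).range) : Z.det ∈ D := by
  have h1 : Z.det = detRows e (fun a => Z (e (Sum.inr a))) (fun i => Z (e (Sum.inl i))) := by
    change Z.det = Matrix.det _
    congr 1
    ext k j
    obtain ⟨k | k, rfl⟩ := e.surjective k <;> simp
  rw [h1, ← mul_one D]
  refine AlternatingMap.apply_mem_mul _ _ D 1 hD fun I => ?_
  have hW (k l) : Sum.elim (fun j => (Pi.single (I j) 1 : κ → T)) (fun a => Z (e (Sum.inr a)))
      (e.symm k) l ∈ (algebraMap R T).range := by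
    rcases e.symm k with j | a
    · simp only [Sum.elim_inl, Pi.single_apply]
      split_ifs
      exacts [one_mem _, zero_mem _]
    · exact hZ _ _
  choose W hW using hW
  refine Submodule.mem_one.mpr ⟨(Matrix.of W).det, ?_⟩
  rw [RingHom.map_det]
  congr 1
  ext k l
  exact hW k l

section MatrixCore

variable {R T : Type*} [CommRing R] [CommRing T] [Algebra R T] {m n N : ℕ}

/-- The `R`-span of the determinants of the square matrices whose rows are `R`-combinations of the
rows of the identity matrix and of `X`. -/
def rowDetSpan (R : Type*) {T : Type*} [CommRing R] [CommRing T] [Algebra R T] {n N : ℕ}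
    (X : Matrix (Fin N) (Fin n) T) : Submodule R T :=
  Submodule.span R (Set.range fun x : Matrix (Fin n) (Fin n) R × Matrix (Fin n) (Fin N) R =>
    (x.1.map (algebraMap R T) + x.2.map (algebraMap R T) * X).det)

/-- The `R`-span of the determinants of the square matrices whose columns are `R`-combinations of
the columns of `B`. -/
def colDetSpan (T : Type*) {R : Type*} [CommRing R] [CommRing T] [Algebra R T] {m N : ℕ}
    (B : Matrix (Fin m) (Fin N) R) : Submodule R T :=
  Submodule.span R (Set.range fun Y : Matrix (Fin N) (Fin m) R => algebraMap R T (B * Y).det)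

theorem det_mem_rowDetSpan_of_cols {α κ : Type*} [Fintype κ] [DecidableEq κ] [DecidableEq α]
    (e : Fin n ⊕ α ≃ κ) (Z : Matrix κ κ T) (X : Matrix (Fin N) (Fin n) T)
    (hX : ∀ k, ∃ (a : Fin n → R) (c : Fin N → R), ∀ i, Z k (e (Sum.inl i))
      = algebraMap R T (a i) + ∑ j, algebraMap R T (c j) * X j i)
    (hZ : ∀ a k, Z k (e (Sum.inr a)) ∈ (algebraMap R T).range) : Z.det ∈ rowDetSpan R X := by
  choose a c h using hX
  rw [← Matrix.det_transpose]
  refine Matrix.det_mem_of_rows (R := R) e _ _ (fun I => ?_) (fun k => hZ k)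
  refine Submodule.subset_span ⟨⟨Matrix.of fun i j => a (I i) j, Matrix.of fun i j => c (I i) j⟩, ?_⟩
  dsimp only
  rw [← Matrix.det_transpose]
  congr 1
  ext i j
  simp [h, Matrix.mul_apply]

theorem span_det_mul_add_eq (B : Matrix (Fin m) (Fin N) R) (C : Matrix (Fin N) (Fin m) T)
    (E : Matrix (Fin N) (Fin N) R) (G : Matrix (Fin m) (Fin n) R)
    (hBC : B.map (algebraMap R T) * C = 1)
    (hCB : C * B.map (algebraMap R T) = E.map (algebraMap R T)) :
    Submodule.span R (Set.range fun x : Matrix (Fin N) (Fin m) R × Matrix (Fin n) (Fin m) R =>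
      algebraMap R T (B * x.1 + G * x.2).det)
      = colDetSpan T B * rowDetSpan R (C * G.map (algebraMap R T)) := by
  set φ := algebraMap R T
  have hBX : B.map φ * (C * G.map φ) = G.map φ := by rw [← Matrix.mul_assoc, hBC, Matrix.one_mul]
  apply le_antisymm
  · rw [Submodule.span_le]
    rintro _ ⟨⟨Y, A⟩, rfl⟩
    set V : Matrix (Fin N) (Fin m) T := Y.map φ + C * G.map φ * A.map φ with hV
    let f : (Fin N → T) [⋀^Fin m]→ₗ[T] T :=
      Matrix.detRowAlternating.compLinearMap (Matrix.vecMulLinear V)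
    have h1 : φ (B * Y + G * A).det = f (B.map φ) := by
      change _ = Matrix.det fun i => Matrix.vecMul (B.map φ i) V
      rw [RingHom.map_det]
      congr 1
      change (B * Y + G * A).map φ = B.map φ * V
      rw [hV, Matrix.mul_add, ← Matrix.mul_assoc, hBX]
      simp [Matrix.map_add]
    change φ (B * Y + G * A).det ∈ _
    rw [h1]
    refine AlternatingMap.apply_mem_mul _ _ _ _ (fun I => ?_) fun I => ?_
    · refine Submodule.subset_span ⟨Matrix.of fun i j => if i = I j then 1 else 0, ?_⟩
      change φ _ = _
      rw [RingHom.map_det]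
      congr 1
      ext i j
      simp [Matrix.mul_apply]
    · have h2 : f (fun j => Pi.single (I j) 1) = (Matrix.fromBlocks 1 (-A.map φ)
          (Matrix.of fun i j => (C * G.map φ) (I i) j) (Matrix.of fun i j => φ (Y (I i) j))).det := by
        rw [Matrix.det_fromBlocks_one₁₁]
        change Matrix.det (fun i => Matrix.vecMul (Pi.single (I i) 1) V) = _
        congr 1
        ext i j
        simp [hV, Matrix.mul_apply]
      rw [h2]
      refine det_mem_rowDetSpan_of_cols (Equiv.refl _) _ _ ?_ ?_
      · rintro (k | k)
        · refine ⟨fun i => (1 : Matrix _ _ R) k i, 0, fun i => ?_⟩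
          by_cases h : k = i <;> simp [h, Matrix.one_apply]
        · refine ⟨0, fun j => if j = I k then 1 else 0, fun i => ?_⟩
          simp
      · rintro a (k | k)
        · exact ⟨-A k a, by simp [φ]⟩
        · exact ⟨Y (I k) a, by simp [φ]⟩
  · rw [colDetSpan, rowDetSpan, Submodule.span_mul_span, Submodule.span_le]
    rintro _ ⟨_, ⟨Y, rfl⟩, _, ⟨⟨A, D⟩, rfl⟩, rfl⟩
    have h1 : φ (B * Y).det * (A.map φ + D.map φ * (C * G.map φ)).det
        = (Matrix.fromBlocks ((B * Y).map φ) (-G.map φ) ((D * E * Y).map φ) (A.map φ)).det := by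
      have h2 : Matrix.fromBlocks 1 0 (-(D.map φ * C)) 1
            * Matrix.fromBlocks ((B * Y).map φ) (-G.map φ) ((D * E * Y).map φ) (A.map φ)
          = Matrix.fromBlocks ((B * Y).map φ) (-G.map φ) 0
              (A.map φ + D.map φ * (C * G.map φ)) := by
        rw [Matrix.fromBlocks_multiply]
        congr 1
        · simp
        · simp
        · simp only [Matrix.map_mul, ← hCB, Matrix.neg_mul, Matrix.one_mul]
          simp [Matrix.mul_assoc]
        · simp [Matrix.mul_assoc, add_comm]
      have h3 := congrArg Matrix.det h2
      rw [Matrix.det_mul, Matrix.det_fromBlocks_zero₁₂, Matrix.det_fromBlocks_zero₂₁] at h3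
      rw [RingHom.map_det]
      simpa using h3.symm
    simp only
    rw [h1]
    refine Matrix.det_mem_of_rows (R := R) (Equiv.refl _) _ _ (fun I => ?_) ?_
    · refine Submodule.subset_span ⟨⟨Matrix.of fun i j => Sum.elim (Y i) 0 (I j),
        Matrix.of fun i j => Sum.elim 0 (fun k => if i = k then -1 else 0) (I j)⟩, ?_⟩
      simp only [RingHom.map_det]
      congr 1
      ext i j
      simp only [RingHom.mapMatrix_apply, Matrix.map_apply, Matrix.add_apply, Matrix.of_apply,
        Matrix.mul_apply, Equiv.refl_apply]
      rcases I j with k | k <;> simp [Matrix.mul_apply, φ]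
    · rintro a (k | k)
      · exact ⟨_, rfl⟩
      · exact ⟨_, rfl⟩

theorem span_det_syzygy_eq (B : Matrix (Fin n) (Fin N) R) (C : Matrix (Fin N) (Fin n) T)
    (E : Matrix (Fin N) (Fin N) R) (H : Matrix (Fin m) (Fin N) R) (X : Matrix (Fin m) (Fin n) T)
    (hBC : B.map (algebraMap R T) * C = 1)
    (hCB : C * B.map (algebraMap R T) = E.map (algebraMap R T))
    (hH : X * B.map (algebraMap R T) = H.map (algebraMap R T)) :
    Submodule.span R (Set.range fun x :
        Matrix (Fin N) (Fin N) R × Matrix (Fin N) (Fin n) R × Matrix (Fin N) (Fin m) R =>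
      algebraMap R T (x.1 * (1 - E) + x.2.1 * B + x.2.2 * H).det)
      = colDetSpan T B * rowDetSpan R X := by
  set φ := algebraMap R T
  have hdet (M : Matrix (Fin N) (Fin N) R) (W : Matrix (Fin N) (Fin n) T) :
      (M.map φ * (1 - E.map φ) + W * B.map φ).det
        = (Matrix.fromBlocks (M.map φ) W (-B.map φ) 0).det := by
    have h2 : Matrix.fromBlocks (M.map φ) (W - M.map φ * C) (-B.map φ) 1
        * Matrix.fromBlocks 1 C 0 1 = Matrix.fromBlocks (M.map φ) W (-B.map φ) 0 := by
      simp [Matrix.fromBlocks_multiply, hBC]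
    rw [← h2, Matrix.det_mul, Matrix.det_fromBlocks_one₂₂, Matrix.det_fromBlocks_zero₂₁, ← hCB]
    simp only [Matrix.det_one, mul_one]
    congr 1
    simp only [Matrix.mul_sub, Matrix.sub_mul, Matrix.mul_neg, Matrix.mul_one, Matrix.mul_assoc]
    abel
  have hdet' (M : Matrix (Fin N) (Fin N) R) (A : Matrix (Fin N) (Fin n) R)
      (D : Matrix (Fin N) (Fin m) R) : φ (M * (1 - E) + A * B + D * H).det
        = (Matrix.fromBlocks (M.map φ) (A.map φ + D.map φ * X) (-B.map φ) 0).det := by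
    rw [← hdet, RingHom.map_det]
    congr 1
    rw [Matrix.add_mul, Matrix.mul_assoc, hH, ← add_assoc]
    change Matrix.map _ φ = _
    simp [Matrix.map_add, Matrix.map_sub, Matrix.map_one]
  apply le_antisymm
  · rw [Submodule.span_le]
    rintro _ ⟨⟨M, A, D⟩, rfl⟩
    let f : (Fin N → T) [⋀^Fin n]→ₗ[T] T :=
      (detRows (Equiv.sumComm (Fin n) (Fin N))
        (fun a => Sum.elim (M.map φ a) ((A.map φ + D.map φ * X) a))).compLinearMap
        (LinearMap.pi (Sum.elim (fun k => -LinearMap.proj k) 0))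
    have hf (v : Fin n → Fin N → T) : f v
        = (Matrix.fromBlocks (M.map φ) (A.map φ + D.map φ * X) (-Matrix.of v) 0).det := by
      change Matrix.det _ = _
      congr 1
      ext (i | i) (j | j) <;> rfl
    have h1 : φ (M * (1 - E) + A * B + D * H).det = f (B.map φ) :=
      (hdet' M A D).trans (hf _).symm
    change φ (M * (1 - E) + A * B + D * H).det ∈ _
    rw [h1]
    refine AlternatingMap.apply_mem_mul _ _ _ _ (fun I => ?_) fun I => ?_
    · refine Submodule.subset_span ⟨Matrix.of fun i j => if i = I j then 1 else 0, ?_⟩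
      change φ _ = _
      rw [RingHom.map_det]
      congr 1
      ext i j
      simp [Matrix.mul_apply]
    · rw [hf]
      refine det_mem_rowDetSpan_of_cols (Equiv.sumComm _ _) _ _ ?_ ?_
      · rintro (k | k)
        · refine ⟨fun i => A k i, fun j => D k j, fun i => ?_⟩
          simp [Matrix.mul_apply, φ]
        · exact ⟨0, 0, fun i => by simp⟩
      · rintro a (k | k)
        · exact ⟨M k a, by simp [φ]⟩
        · exact ⟨-Pi.single (M := fun _ => R) (I k) 1 a, by simp [φ, Pi.single_apply]⟩
  · rw [colDetSpan, rowDetSpan, Submodule.span_mul_span, Submodule.span_le]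
    rintro _ ⟨_, ⟨Y, rfl⟩, _, ⟨⟨A, D⟩, rfl⟩, rfl⟩
    refine Submodule.subset_span ⟨⟨1, Y * A, Y * D⟩, ?_⟩
    change φ _ = φ (B * Y).det * (A.map φ + D.map φ * X).det
    rw [hdet', RingHom.map_det, Matrix.map_one _ (map_zero φ) (map_one φ),
      Matrix.det_fromBlocks_one₁₁, ← Matrix.det_mul]
    congr 1
    simp [Matrix.mul_add, Matrix.mul_assoc, add_comm]

end MatrixCore

section FittingPresentation

variable {R : Type} [CommRing R] {M : Type} [AddCommGroup M] [Module R M]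

/-- Fitting's lemma: the Fitting ideal can be computed from any one presentation. -/
theorem fittingIdeal_eq_span {a : ℕ} (π : (Fin a → R) →ₗ[R] M) (hπ : Function.Surjective π) :
    fittingIdeal R M = Ideal.span
      {x : R | ∃ A : Matrix (Fin a) (Fin a) R, (∀ j, π (fun i => A i j) = 0) ∧ x = A.det} := by
  apply le_antisymm
  · rw [fittingIdeal, Ideal.span_le]
    rintro _ ⟨b, A, π', hπ', hA, rfl⟩
    obtain ⟨α, hα⟩ := Module.projective_lifting_property π π' hπ
    obtain ⟨β, hβ⟩ := Module.projective_lifting_property π' π hπ'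
    have hα' (v) : π (α.toMatrix'.mulVec v) = π' v := by
      rw [LinearMap.toMatrix'_mulVec]; exact LinearMap.congr_fun hα v
    have hβ' (v) : π' (β.toMatrix'.mulVec v) = π v := by
      rw [LinearMap.toMatrix'_mulVec]; exact LinearMap.congr_fun hβ v
    set P := α.toMatrix'
    set Q := β.toMatrix'
    have h2 : Matrix.fromBlocks 1 P 0 1 * Matrix.fromBlocks (1 - P * Q) (P * A) Q (-A)
        = Matrix.fromBlocks 1 0 Q (-A) := by
      simp [Matrix.fromBlocks_multiply]
    have h3 := congrArg Matrix.det h2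
    rw [Matrix.det_mul, Matrix.det_fromBlocks_zero₂₁, Matrix.det_fromBlocks_zero₁₂] at h3
    simp only [Matrix.det_one, one_mul, Matrix.det_neg, Fintype.card_fin] at h3
    have h4 : A.det = (-1) ^ b * (Matrix.fromBlocks (1 - P * Q) (P * A) Q (-A)).det := by
      rw [h3, ← mul_assoc, ← mul_pow]; simp
    rw [h4]
    refine Ideal.mul_mem_left _ _ ?_
    refine Matrix.det_mem_of_rows (R := R) (Equiv.refl _) _ _ (fun I => ?_) fun _ _ => ⟨_, rfl⟩
    refine Ideal.subset_span ⟨_, fun j => ?_, rfl⟩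
    rcases h : I j with k | k
    · have h5 : (fun i => Matrix.of (fun i j => Matrix.fromBlocks (1 - P * Q) (P * A) Q (-A)
          (Equiv.refl _ (Sum.inl i)) (I j)) i j) = Pi.single k 1 - P.mulVec (Q.mulVec (Pi.single k 1)) := by
        ext i
        simp [h, Matrix.one_apply, Pi.single_apply, Matrix.mul_apply, Matrix.mulVec, dotProduct]
      rw [h5, map_sub, hα', hβ', sub_self]
    · have h5 : (fun i => Matrix.of (fun i j => Matrix.fromBlocks (1 - P * Q) (P * A) Q (-A)
          (Equiv.refl _ (Sum.inl i)) (I j)) i j) = P.mulVec (fun i => A i k) := by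
        ext i
        simp [h, Matrix.mul_apply, Matrix.mulVec, dotProduct]
      rw [h5, hα', hA]
  · rw [Ideal.span_le]
    rintro _ ⟨A, hA, rfl⟩
    exact Ideal.subset_span ⟨a, A, π, hπ, hA, rfl⟩

theorem fittFrac_eq_span (S : Submonoid R) {a : ℕ} (π : (Fin a → R) →ₗ[R] M)
    (hπ : Function.Surjective π) {X : Type} (F : X → Matrix (Fin a) (Fin a) R)
    (hF : ∀ A : Matrix (Fin a) (Fin a) R, (∀ j, π (fun i => A i j) = 0) ↔ ∃ x, A = F x) :
    fittFrac R S M = Submodule.span R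
      (Set.range fun x => algebraMap R (Localization S) (F x).det) := by
  rw [fittFrac, fittingIdeal_eq_span π hπ, Ideal.span, Submodule.map_span]
  congr 1
  ext t
  constructor
  · rintro ⟨_, ⟨A, hA, rfl⟩, rfl⟩
    obtain ⟨x, rfl⟩ := (hF A).1 hA
    exact ⟨x, rfl⟩
  · rintro ⟨x, rfl⟩
    exact ⟨_, ⟨F x, (hF _).2 ⟨x, rfl⟩, rfl⟩, rfl⟩

end FittingPresentation

section ExtVanishing

variable {R : Type} [CommRing R]

/-- Vanishing of `Ext^i_R(N, R)`, for the `Ext` groups defined through the derived category. -/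
def AbelianExtVanish (R : Type) [CommRing R] (N : Type) [AddCommGroup N] [Module R N] (i : ℕ) :
    Prop :=
  Subsingleton (Abelian.Ext.{0} (ModuleCat.of R N) (ModuleCat.of R R) i)

theorem ExtRVanish.abelianExtVanish {N : Type} [AddCommGroup N] [Module R N] {i : ℕ}
    (h : ExtRVanish R N (i + 1)) : AbelianExtVanish R N (i + 1) := by
  let P := projectiveResolution (ModuleCat.of R N)
  refine subsingleton_of_forall_eq 0 fun α => ?_
  obtain ⟨f, hf, rfl⟩ := P.extMk_surjective α (i + 2) rfl
  rw [P.extMk_eq_zero_iff f (i + 2) rfl hf i rfl]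
  have h0 : Limits.IsZero (((_root_.Ext ℤ (ModuleCat R) (i + 1)).obj
      (Opposite.op (ModuleCat.of R N))).obj (ModuleCat.of R R)) :=
    have : Subsingleton (extGroup R N R (i + 1)) := h
    ModuleCat.isZero_of_subsingleton _
  have h1 := h0.of_iso (P.isoExt (R := ℤ) (i + 1) (ModuleCat.of R R)).symm
  rw [← HomologicalComplex.exactAt_iff_isZero_homology, HomologicalComplex.exactAt_iff' _ i _ (i + 2)
    (by simp) (by simp), ShortComplex.moduleCat_exact_iff] at h1
  obtain ⟨g, hg⟩ := h1 f hf
  exact ⟨g, hg⟩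

variable {K F N : Type} [AddCommGroup K] [Module R K] [AddCommGroup F] [Module R F]
  [AddCommGroup N] [Module R N] {f : K →ₗ[R] F} {g : F →ₗ[R] N}

theorem shortExact_of_exact (hf : Function.Injective f) (hfg : Function.Exact f g)
    (hg : Function.Surjective g) :
    (ShortComplex.mk (ModuleCat.ofHom f) (ModuleCat.ofHom g)
      (by rw [← ModuleCat.ofHom_comp, hfg.linearMap_comp_eq_zero]; rfl)).ShortExact where
  exact := by
    rw [ShortComplex.ShortExact.moduleCat_exact_iff_function_exact]
    exact hfg
  mono_f := (ModuleCat.mono_iff_injective _).2 hf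
  epi_g := (ModuleCat.epi_iff_surjective _).2 hg

theorem AbelianExtVanish.of_exact [Module.Projective R F] (hf : Function.Injective f)
    (hfg : Function.Exact f g) (hg : Function.Surjective g) {i : ℕ}
    (h : AbelianExtVanish R N (i + 2)) : AbelianExtVanish R K (i + 1) := by
  have hS := shortExact_of_exact hf hfg hg
  have : Subsingleton (Abelian.Ext (ModuleCat.of R N) (ModuleCat.of R R) (i + 2)) := h
  have : Projective (ModuleCat.of R F) := (IsProjective.iff_projective F).1 ‹_›
  refine subsingleton_of_forall_eq 0 fun α => ?_
  obtain ⟨β, rfl⟩ := Abelian.Ext.contravariant_sequence_exact₁ hS (ModuleCat.of R R) α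
    (n₁ := i + 2) (by lia) (Subsingleton.elim _ _)
  rw [Abelian.Ext.eq_zero_of_projective (P := ModuleCat.of R F) β, Abelian.Ext.comp_zero]

theorem AbelianExtVanish.exists_extension (hf : Function.Injective f)
    (hfg : Function.Exact f g) (hg : Function.Surjective g)
    (h : AbelianExtVanish R N 1) (φ : K →ₗ[R] R) : ∃ ψ : F →ₗ[R] R, ψ ∘ₗ f = φ := by
  have hS := shortExact_of_exact hf hfg hg
  have : Subsingleton (Abelian.Ext (ModuleCat.of R N) (ModuleCat.of R R) 1) := h
  obtain ⟨β, hβ⟩ := Abelian.Ext.contravariant_sequence_exact₁ hS (ModuleCat.of R R)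
    (Abelian.Ext.mk₀ (ModuleCat.ofHom φ)) (n₁ := 1) (by lia)
    (Subsingleton.elim _ _)
  obtain ⟨ψ, rfl⟩ := (Abelian.Ext.mk₀_bijective _ _).2 β
  rw [Abelian.Ext.mk₀_comp_mk₀] at hβ
  have := (Abelian.Ext.mk₀_bijective _ _).1 hβ
  exact ⟨ψ.hom, congrArg ModuleCat.Hom.hom this⟩

end ExtVanishing

section DualPresentation

variable {R : Type} [CommRing R]

theorem LinearMap.exists_eq_subtype_comp {F K : Type} [AddCommGroup F] [Module R F]
    [AddCommGroup K] [Module R K] (Q : Submodule R F) (u : K →ₗ[R] F) (hu : ∀ x, u x ∈ Q) :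
    ∃ v : K →ₗ[R] Q, ∀ x, (v x : F) = u x :=
  ⟨u.codRestrict Q hu, fun _ => rfl⟩

theorem exists_dual_presentation {M P₁ P₂ Nq F₁ F₂ F K : Type} [AddCommGroup M] [Module R M]
    [AddCommGroup P₁] [Module R P₁] [AddCommGroup P₂] [Module R P₂] [AddCommGroup Nq] [Module R Nq]
    [AddCommGroup F₁] [Module R F₁] [AddCommGroup F₂] [Module R F₂] [AddCommGroup F] [Module R F]
    [AddCommGroup K] [Module R K] [Module.Projective R F₁] [Module.Projective R F₂]
    [Module.Projective R F]
    {f : M →ₗ[R] P₁} {g : P₁ →ₗ[R] P₂} {h : P₂ →ₗ[R] Nq}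
    (hf : Function.Injective f) (hfg : Function.Exact f g) (hgh : Function.Exact g h)
    (hh : Function.Surjective h) (hN : PdStarLE1 R Nq)
    {ι : K →ₗ[R] F} {π : F →ₗ[R] M}
    (hι : Function.Injective ι) (hπ : Function.Surjective π) (hex : Function.Exact ι π)
    {π₁ : F₁ →ₗ[R] P₁} {π₂ : F₂ →ₗ[R] P₂} (hπ₁ : Function.Surjective π₁)
    (hπ₂ : Function.Surjective π₂) [Module.Projective R (LinearMap.ker π₁)]
    [Module.Projective R (LinearMap.ker π₂)]
    {G : F₁ →ₗ[R] F₂} (hG : ∀ x, π₂ (G x) = g (π₁ x))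
    {H : LinearMap.ker π₁ →ₗ[R] LinearMap.ker π₂} (hH : ∀ x, (H x : F₂) = G x) :
    ∃ Φ : (LinearMap.ker π₁ →ₗ[R] R) →ₗ[R] ExtOneDualComm R ι, Function.Surjective Φ ∧
      ∀ β, Φ β = 0 ↔ ∃ (a : F₁ →ₗ[R] R) (b : LinearMap.ker π₂ →ₗ[R] R),
        β = a ∘ₗ (LinearMap.ker π₁).subtype + b ∘ₗ H := by
  -- the pullback of `M` along `π₁`
  let L : Submodule R F₁ := LinearMap.ker (π₂ ∘ₗ G)
  have hL (x : F₁) : x ∈ L ↔ π₂ (G x) = 0 := Iff.rfl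
  obtain ⟨r, hr⟩ : ∃ r : L →ₗ[R] M, ∀ x, f (r x) = π₁ x := by
    obtain ⟨v, hv⟩ := LinearMap.exists_eq_subtype_comp (LinearMap.range f) (π₁ ∘ₗ L.subtype)
      fun x => (hfg _).1 ((hG x).symm.trans x.2)
    refine ⟨(LinearEquiv.ofInjective f hf).symm.toLinearMap ∘ₗ v, fun x => ?_⟩
    have := congrArg Subtype.val ((LinearEquiv.ofInjective f hf).apply_symm_apply (v x))
    exact this.trans (hv x)
  have hr_surj : Function.Surjective r := fun y => by
    obtain ⟨x, hx⟩ := hπ₁ (f y)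
    exact ⟨⟨x, (hL x).2 (by rw [hG, hx, hfg.apply_apply_eq_zero])⟩, hf ((hr _).trans hx)⟩
  have hr_ker (x : L) : r x = 0 ↔ (x : F₁) ∈ LinearMap.ker π₁ := by
    rw [LinearMap.mem_ker, ← hr, map_eq_zero_iff f hf]
  obtain ⟨inc, hinc⟩ := LinearMap.exists_eq_subtype_comp L (LinearMap.ker π₁).subtype fun x => by
    rw [hL, hG, Submodule.subtype_apply, LinearMap.mem_ker.1 x.2, map_zero]
  obtain ⟨G', hG'⟩ := LinearMap.exists_eq_subtype_comp (LinearMap.ker π₂) (G ∘ₗ L.subtype)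
    fun x => x.2
  -- the pullback has trivial `Ext` into `R`
  have hpex : Function.Exact (LinearMap.ker (h ∘ₗ π₂)).subtype (h ∘ₗ π₂) :=
    LinearMap.exact_subtype_ker_map _
  have hpsurj : Function.Surjective (h ∘ₗ π₂) := hh.comp hπ₂
  have hZ2 := (hN 3 (by lia)).abelianExtVanish.of_exact (Submodule.subtype_injective _) hpex hpsurj
  have hZ1 := (hN 2 le_rfl).abelianExtVanish.of_exact (Submodule.subtype_injective _) hpex hpsurj
  obtain ⟨d, hd⟩ := LinearMap.exists_eq_subtype_comp (LinearMap.ker (h ∘ₗ π₂))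
    (G.coprod (-(LinearMap.ker π₂).subtype)) fun x => by
      simp [hG, hgh.apply_apply_eq_zero]
  have hd_surj : Function.Surjective d := fun z => by
    obtain ⟨y, hy⟩ := (hgh _).1 z.2
    obtain ⟨x, rfl⟩ := hπ₁ y
    refine ⟨(x, ⟨G x - z, ?_⟩), Subtype.ext ?_⟩
    · rw [LinearMap.mem_ker, map_sub, hG, hy, sub_self]
    · simp [hd]
  have hj_inj : Function.Injective (L.subtype.prod G') := fun x y hxy =>
    Subtype.ext (congrArg Prod.fst hxy)
  have hjd : Function.Exact (L.subtype.prod G') d := fun x => by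
    have hdx : d x = 0 ↔ G x.1 = x.2 := by
      rw [Subtype.ext_iff, hd]
      simp [add_neg_eq_zero]
    rw [hdx]
    constructor
    · intro hx
      refine ⟨⟨x.1, (hL _).2 ?_⟩, Prod.ext rfl (Subtype.ext ?_)⟩
      · rw [hx]; exact x.2.2
      · exact (hG' _).trans hx
    · rintro ⟨y, rfl⟩
      exact (hG' y).symm
  have hLvan := hZ2.of_exact hj_inj hjd hd_surj
  have hLext (ψ : L →ₗ[R] R) : ∃ (a : F₁ →ₗ[R] R) (b : LinearMap.ker π₂ →ₗ[R] R),
      ∀ x, ψ x = a x + b (G' x) := by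
    obtain ⟨θ, rfl⟩ := hZ1.exists_extension hj_inj hjd hd_surj ψ
    refine ⟨θ ∘ₗ LinearMap.inl R _ _, θ ∘ₗ LinearMap.inr R _ _, fun x => ?_⟩
    simp [← map_add]
  have hG'inc (x) : G' (inc x) = H x := Subtype.ext <| by rw [hG', hH]; simp [hinc]
  -- the comparison of the two presentations of `M`
  obtain ⟨σ, hσ⟩ := Module.projective_lifting_property r π hr_surj
  replace hσ (x) : r (σ x) = π x := LinearMap.congr_fun hσ x
  obtain ⟨τ, hτ⟩ := LinearMap.exists_eq_subtype_comp (LinearMap.ker π₁) (L.subtype ∘ₗ σ ∘ₗ ι)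
    fun x => (hr_ker _).1 <| by simp [hσ, hex.apply_apply_eq_zero]
  have hincτ (x) : inc (τ x) = σ (ι x) := Subtype.ext <| by rw [hinc]; simp [hτ]
  have hk_inj : Function.Injective (ι.prod (-τ)) := fun x y hxy => hι (congrArg Prod.fst hxy)
  have hq_surj : Function.Surjective (σ.coprod inc) := fun y => by
    obtain ⟨x, hx⟩ := hπ (r y)
    refine ⟨(x, ⟨y - σ x, (hr_ker (y - σ x)).1 (by rw [map_sub, hσ, hx, sub_self])⟩),
      Subtype.ext ?_⟩
    simp [hinc]
  have hkq : Function.Exact (ι.prod (-τ)) (σ.coprod inc) := fun x => by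
    constructor
    · intro hx
      rw [LinearMap.coprod_apply] at hx
      have h1 : π x.1 = 0 := by
        rw [← hσ, eq_neg_of_add_eq_zero_left hx, map_neg, neg_eq_zero, hr_ker, hinc]
        exact x.2.2
      obtain ⟨y, hy⟩ := (hex _).1 h1
      refine ⟨y, Prod.ext hy (Subtype.ext ?_)⟩
      have h2 := congrArg Subtype.val hx
      simp only [Submodule.coe_add, hinc, Submodule.subtype_apply, Submodule.coe_zero, ← hy] at h2
      simpa [hτ] using neg_eq_of_add_eq_zero_right h2
    · rintro ⟨y, rfl⟩
      simp [hincτ]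
  have hmem (κ : K →ₗ[R] R) : κ ∈ LinearMap.range (precompDualComm R ι) ↔
      ∃ u : F →ₗ[R] R, u ∘ₗ ι = κ := Iff.rfl
  refine ⟨Submodule.mkQ _ ∘ₗ LinearMap.lcomp R R τ, fun y => ?_, fun β => ?_⟩
  · obtain ⟨κ, rfl⟩ := Submodule.mkQ_surjective _ y
    obtain ⟨θ, hθ⟩ := hLvan.exists_extension hk_inj hkq hq_surj κ
    refine ⟨-(θ ∘ₗ LinearMap.inr R _ _), ?_⟩
    rw [LinearMap.comp_apply, Submodule.mkQ_apply, Submodule.mkQ_apply, Submodule.Quotient.eq, hmem]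
    refine ⟨-(θ ∘ₗ LinearMap.inl R _ _), ?_⟩
    ext x
    have h1 := LinearMap.congr_fun hθ x
    have h2 : (ι x, -τ x) = (ι x, 0) + (0, -τ x) := by simp
    have h3 : ((0 : F), -τ x) = -(0, τ x) := by simp
    change θ (ι x, -τ x) = κ x at h1
    rw [h2, map_add, h3, map_neg] at h1
    simp [← h1]
  · rw [LinearMap.comp_apply, Submodule.mkQ_apply, Submodule.Quotient.mk_eq_zero, hmem]
    constructor
    · rintro ⟨u, hu⟩
      obtain ⟨ψ, hψ⟩ : ∃ ψ : L →ₗ[R] R, ψ ∘ₗ σ.coprod inc = u.coprod β := by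
        have hle : LinearMap.ker (σ.coprod inc) ≤ LinearMap.ker (u.coprod β) := fun x hx => by
          obtain ⟨y, rfl⟩ := (hkq x).1 hx
          have := LinearMap.congr_fun hu y
          simp only [LinearMap.comp_apply, LinearMap.lcomp_apply] at this
          simp [this]
        refine ⟨(LinearMap.ker (σ.coprod inc)).liftQ _ hle ∘ₗ
          ((σ.coprod inc).quotKerEquivOfSurjective hq_surj).symm.toLinearMap, ?_⟩
        refine LinearMap.ext fun x => ?_
        have : (σ.coprod inc).quotKerEquivOfSurjective hq_surj (Submodule.Quotient.mk x)
          = (σ.coprod inc) x := rfl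
        rw [LinearMap.comp_apply, ← this, LinearMap.comp_apply, LinearEquiv.coe_coe,
          LinearEquiv.symm_apply_apply]
        rfl
      obtain ⟨a, b, hab⟩ := hLext ψ
      refine ⟨a, b, ?_⟩
      ext x
      have h1 := LinearMap.congr_fun hψ (0, x)
      simp only [LinearMap.comp_apply, LinearMap.coprod_apply, map_zero, zero_add] at h1
      rw [← h1, hab, hG'inc, hinc]
      rfl
    · rintro ⟨a, b, rfl⟩
      refine ⟨(a ∘ₗ L.subtype + b ∘ₗ G') ∘ₗ σ, ?_⟩
      ext x
      simp [← hincτ, hG'inc, hinc]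

end DualPresentation

section Matrices

variable {R : Type} [CommRing R] {S : Submonoid R} {P : Type} [AddCommGroup P] [Module R P]

theorem STorsion.exists_smul_eq_zero [Module.Finite R P] (h : STorsion R S P) :
    ∃ s ∈ S, ∀ x : P, s • x = 0 := by
  obtain ⟨t, ht⟩ := Module.Finite.fg_top (R := R) (M := P)
  choose s hs hsx using h
  refine ⟨∏ x ∈ t, s x, prod_mem fun x _ => hs x, fun x => ?_⟩
  have hx : x ∈ Submodule.span R (t : Set P) := ht ▸ Submodule.mem_top
  induction hx using Submodule.span_induction with
  | mem y hy =>
    obtain ⟨c, hc⟩ := Finset.dvd_prod_of_mem s hy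
    rw [hc, mul_comm, mul_smul, hsx, smul_zero]
  | zero => exact smul_zero _
  | add y z _ _ hy hz => rw [smul_add, hy, hz, add_zero]
  | smul a y _ hy => rw [smul_comm, hy, smul_zero]

theorem PdLE.exists_split_presentation [IsNoetherianRing R] (h : PdLE R 1 P) :
    ∃ (n N : ℕ) (π : (Fin n → R) →ₗ[R] P) (p : (Fin N → R) →ₗ[R] LinearMap.ker π)
      (i : LinearMap.ker π →ₗ[R] (Fin N → R)),
      Function.Surjective π ∧ Module.Projective R (LinearMap.ker π) ∧ p ∘ₗ i = LinearMap.id := by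
  obtain ⟨n, π, hπ, hproj⟩ := h
  have hproj : Module.Projective R (LinearMap.ker π) := hproj
  obtain ⟨N, p, hp⟩ := Module.Finite.exists_fin' R (LinearMap.ker π)
  obtain ⟨i, hi⟩ := Module.projective_lifting_property p LinearMap.id hp
  exact ⟨n, N, π, p, i, hπ, hproj, hi⟩

variable {n N : ℕ} {π : (Fin n → R) →ₗ[R] P} {p : (Fin N → R) →ₗ[R] LinearMap.ker π}
  {i : LinearMap.ker π →ₗ[R] (Fin N → R)}

theorem exists_localized_inverse [Module.Finite R P] (hP : STorsion R S P)
    (hpi : p ∘ₗ i = LinearMap.id) :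
    ∃ C : Matrix (Fin N) (Fin n) (Localization S),
      ((LinearMap.ker π).subtype ∘ₗ p).toMatrix'.map (algebraMap R (Localization S)) * C = 1 ∧
      C * ((LinearMap.ker π).subtype ∘ₗ p).toMatrix'.map (algebraMap R (Localization S))
        = (i ∘ₗ p).toMatrix'.map (algebraMap R (Localization S)) := by
  obtain ⟨s, hs, hsP⟩ := hP.exists_smul_eq_zero
  obtain ⟨m, hm⟩ := LinearMap.exists_eq_subtype_comp (LinearMap.ker π)
    (s • LinearMap.id) fun x => by simp [hsP]
  obtain ⟨u, hu⟩ := IsLocalization.map_units (Localization S) (⟨s, hs⟩ : S)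
  replace hu : (u : Localization S) = algebraMap R (Localization S) s := hu
  have hpi' (x) : p (i x) = x := LinearMap.congr_fun hpi x
  set φ := algebraMap R (Localization S)
  have h1 : ((LinearMap.ker π).subtype ∘ₗ p).toMatrix' * (i ∘ₗ m).toMatrix'
      = s • (1 : Matrix (Fin n) (Fin n) R) := by
    rw [← LinearMap.toMatrix'_comp, ← LinearMap.toMatrix'_id, ← map_smul]
    congr 1
    refine LinearMap.ext fun x => ?_
    simp [hpi', hm]
  have h2 : (i ∘ₗ m).toMatrix' * ((LinearMap.ker π).subtype ∘ₗ p).toMatrix'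
      = s • (i ∘ₗ p).toMatrix' := by
    rw [← LinearMap.toMatrix'_comp, ← map_smul]
    congr 1
    refine LinearMap.ext fun x => ?_
    have : m (p x) = s • p x := Subtype.ext (hm _)
    simp [this]
  have hsmul {a b : ℕ} (X : Matrix (Fin a) (Fin b) R) :
      (↑u⁻¹ : Localization S) • (s • X).map φ = X.map φ := by
    ext a b
    simp [← hu]
  refine ⟨(↑u⁻¹ : Localization S) • (i ∘ₗ m).toMatrix'.map φ, ?_, ?_⟩
  · rw [Matrix.mul_smul, ← Matrix.map_mul, h1, hsmul, Matrix.map_one _ (map_zero _) (map_one _)]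
  · rw [Matrix.smul_mul, ← Matrix.map_mul, h2, hsmul]

theorem exists_eq_toMatrix'_mul_iff {a b c : ℕ} (q : (Fin b → R) →ₗ[R] (Fin a → R))
    (A : Matrix (Fin a) (Fin c) R) :
    (∀ j, ∃ y, q y = fun i => A i j) ↔ ∃ Y : Matrix (Fin b) (Fin c) R, A = q.toMatrix' * Y := by
  constructor
  · intro h
    choose y hy using h
    refine ⟨(Matrix.of y).transpose, ?_⟩
    ext i j
    rw [← congrFun (hy j) i, ← LinearMap.toMatrix'_mulVec]
    rfl
  · rintro ⟨Y, rfl⟩ j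
    refine ⟨fun i => Y i j, ?_⟩
    rw [← LinearMap.toMatrix'_mulVec]
    rfl

theorem fittFrac_eq_colDetSpan (S : Submonoid R) (hπ : Function.Surjective π)
    (hpi : p ∘ₗ i = LinearMap.id) : fittFrac R S P
      = colDetSpan (Localization S) ((LinearMap.ker π).subtype ∘ₗ p).toMatrix' := by
  refine fittFrac_eq_span S π hπ _ fun A => ?_
  rw [← exists_eq_toMatrix'_mul_iff]
  refine forall_congr' fun j => ⟨fun h => ⟨i ⟨_, h⟩, ?_⟩, ?_⟩
  · have := LinearMap.congr_fun hpi ⟨_, h⟩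
    exact congrArg Subtype.val this
  · rintro ⟨y, hy⟩
    rw [← hy]
    exact (p y).2

theorem fittFrac_eq_span_mul_add (S : Submonoid R) (hπ : Function.Surjective π)
    (hpi : p ∘ₗ i = LinearMap.id) {Q P' : Type} [AddCommGroup Q] [Module R Q] [AddCommGroup P']
    [Module R P'] {g : P' →ₗ[R] P} {h : P →ₗ[R] Q} (hgh : Function.Exact g h)
    (hh : Function.Surjective h) {m : ℕ} {π' : (Fin m → R) →ₗ[R] P'}
    (hπ' : Function.Surjective π') {G : (Fin m → R) →ₗ[R] (Fin n → R)}
    (hG : ∀ x, π (G x) = g (π' x)) : fittFrac R S Q = Submodule.span R (Set.range fun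
      x : Matrix (Fin N) (Fin n) R × Matrix (Fin m) (Fin n) R => algebraMap R (Localization S)
        (((LinearMap.ker π).subtype ∘ₗ p).toMatrix' * x.1 + G.toMatrix' * x.2).det) := by
  refine fittFrac_eq_span S (h ∘ₗ π) (hh.comp hπ) _ fun A => ?_
  have hpi' (x) : p (i x) = x := LinearMap.congr_fun hpi x
  constructor
  · intro hA
    have h1 (j) : ∃ x y, G x + p y = fun i => A i j := by
      obtain ⟨z, hz⟩ := (hgh _).1 (hA j)
      obtain ⟨x, rfl⟩ := hπ' z
      refine ⟨x, i ⟨(fun i => A i j) - G x, ?_⟩, ?_⟩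
      · rw [LinearMap.mem_ker, map_sub, hG, hz, sub_self]
      · simp [hpi']
    choose x y hxy using h1
    refine ⟨((Matrix.of y).transpose, (Matrix.of x).transpose), ?_⟩
    ext i j
    change _ = (((LinearMap.ker π).subtype ∘ₗ p).toMatrix'.mulVec (y j)) i
      + G.toMatrix'.mulVec (x j) i
    rw [← congrFun (hxy j) i, LinearMap.toMatrix'_mulVec, LinearMap.toMatrix'_mulVec, add_comm]
    rfl
  · rintro ⟨⟨Y, X⟩, rfl⟩ j
    have : (fun i => (((LinearMap.ker π).subtype ∘ₗ p).toMatrix' * Y + G.toMatrix' * X) i j)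
        = p (fun i => Y i j) + G (fun i => X i j) := by
      rw [← LinearMap.toMatrix'_mulVec G]
      change _ = ((LinearMap.ker π).subtype ∘ₗ p) (fun i => Y i j) + _
      rw [← LinearMap.toMatrix'_mulVec]
      rfl
    rw [this, LinearMap.comp_apply, map_add, hG, LinearMap.mem_ker.1 (p _).2, zero_add,
      hgh.apply_apply_eq_zero]

end Matrices

section DualFitting

variable {R : Type} [CommRing R]

theorem dotProductEquiv_vecMul {a b : ℕ} (q : (Fin b → R) →ₗ[R] (Fin a → R)) (v : Fin a → R) :
    dotProductEquiv R (Fin b) (Matrix.vecMul v q.toMatrix') = dotProductEquiv R (Fin a) v ∘ₗ q := by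
  refine LinearMap.ext fun x => ?_
  change Matrix.vecMul v q.toMatrix' ⬝ᵥ x = v ⬝ᵥ q x
  rw [← Matrix.dotProduct_mulVec, LinearMap.toMatrix'_mulVec]

theorem dual_comp_section_eq_iff {Q₁ Q₂ : Type} [AddCommGroup Q₁] [Module R Q₁]
    [AddCommGroup Q₂] [Module R Q₂] {n N₁ N₂ : ℕ} {j : Q₁ →ₗ[R] (Fin n → R)}
    {p₁ : (Fin N₁ → R) →ₗ[R] Q₁} {i₁ : Q₁ →ₗ[R] (Fin N₁ → R)} (h₁ : p₁ ∘ₗ i₁ = LinearMap.id)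
    {p₂ : (Fin N₂ → R) →ₗ[R] Q₂} {i₂ : Q₂ →ₗ[R] (Fin N₂ → R)} (h₂ : p₂ ∘ₗ i₂ = LinearMap.id)
    (H : Q₁ →ₗ[R] Q₂) (v : Fin N₁ → R) :
    (∃ (a : (Fin n → R) →ₗ[R] R) (b : Q₂ →ₗ[R] R),
      dotProductEquiv R (Fin N₁) v ∘ₗ i₁ = a ∘ₗ j + b ∘ₗ H) ↔
    ∃ (x : Fin N₁ → R) (y : Fin n → R) (z : Fin N₂ → R),
      v = Matrix.vecMul x (1 - (i₁ ∘ₗ p₁).toMatrix') + Matrix.vecMul y (j ∘ₗ p₁).toMatrix'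
        + Matrix.vecMul z (i₂ ∘ₗ H ∘ₗ p₁).toMatrix' := by
  have h₁' (x) : p₁ (i₁ x) = x := LinearMap.congr_fun h₁ x
  have h₂' (x) : p₂ (i₂ x) = x := LinearMap.congr_fun h₂ x
  have key (x : Fin N₁ → R) (y : Fin n → R) (z : Fin N₂ → R) :
      dotProductEquiv R (Fin N₁) (Matrix.vecMul x (1 - (i₁ ∘ₗ p₁).toMatrix')
        + Matrix.vecMul y (j ∘ₗ p₁).toMatrix' + Matrix.vecMul z (i₂ ∘ₗ H ∘ₗ p₁).toMatrix')
      = dotProductEquiv R (Fin N₁) x - dotProductEquiv R (Fin N₁) x ∘ₗ (i₁ ∘ₗ p₁)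
        + dotProductEquiv R (Fin n) y ∘ₗ (j ∘ₗ p₁)
        + dotProductEquiv R (Fin N₂) z ∘ₗ (i₂ ∘ₗ H ∘ₗ p₁) := by
    rw [map_add, map_add, Matrix.vecMul_sub, map_sub, Matrix.vecMul_one, dotProductEquiv_vecMul,
      dotProductEquiv_vecMul, dotProductEquiv_vecMul]
  constructor
  · rintro ⟨a, b, hab⟩
    refine ⟨v, (dotProductEquiv R (Fin n)).symm a, (dotProductEquiv R (Fin N₂)).symm (b ∘ₗ p₂), ?_⟩
    apply (dotProductEquiv R (Fin N₁)).injective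
    rw [key, LinearEquiv.apply_symm_apply, LinearEquiv.apply_symm_apply, ← LinearMap.comp_assoc,
      hab]
    refine LinearMap.ext fun x => ?_
    simp only [LinearMap.add_apply, LinearMap.sub_apply, LinearMap.comp_apply, h₂']
    ring
  · rintro ⟨x, y, z, rfl⟩
    refine ⟨dotProductEquiv R (Fin n) y, dotProductEquiv R (Fin N₂) z ∘ₗ i₂, ?_⟩
    rw [key]
    refine LinearMap.ext fun x => ?_
    simp only [LinearMap.add_apply, LinearMap.sub_apply, LinearMap.comp_apply, h₁']
    ring

theorem fittFrac_eq_span_syzygy (S : Submonoid R) {Q₁ Q₂ D : Type} [AddCommGroup Q₁] [Module R Q₁]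
    [AddCommGroup Q₂] [Module R Q₂] [AddCommGroup D] [Module R D] {n N₁ N₂ : ℕ}
    {j : Q₁ →ₗ[R] (Fin n → R)}
    {p₁ : (Fin N₁ → R) →ₗ[R] Q₁} {i₁ : Q₁ →ₗ[R] (Fin N₁ → R)} (h₁ : p₁ ∘ₗ i₁ = LinearMap.id)
    {p₂ : (Fin N₂ → R) →ₗ[R] Q₂} {i₂ : Q₂ →ₗ[R] (Fin N₂ → R)} (h₂ : p₂ ∘ₗ i₂ = LinearMap.id)
    {H : Q₁ →ₗ[R] Q₂} {Φ : (Q₁ →ₗ[R] R) →ₗ[R] D} (hΦ : Function.Surjective Φ)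
    (hker : ∀ β, Φ β = 0 ↔ ∃ (a : (Fin n → R) →ₗ[R] R) (b : Q₂ →ₗ[R] R), β = a ∘ₗ j + b ∘ₗ H) :
    fittFrac R S D = Submodule.span R (Set.range fun x : Matrix (Fin N₁) (Fin N₁) R ×
        Matrix (Fin N₁) (Fin n) R × Matrix (Fin N₁) (Fin N₂) R => algebraMap R (Localization S)
      (x.1 * (1 - (i₁ ∘ₗ p₁).toMatrix') + x.2.1 * (j ∘ₗ p₁).toMatrix'
        + x.2.2 * (i₂ ∘ₗ H ∘ₗ p₁).toMatrix').det) := by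
  have hsurj : Function.Surjective
      (Φ ∘ₗ LinearMap.lcomp R R i₁ ∘ₗ (dotProductEquiv R (Fin N₁)).toLinearMap) := fun y => by
    obtain ⟨β, rfl⟩ := hΦ y
    refine ⟨(dotProductEquiv R (Fin N₁)).symm (β ∘ₗ p₁), ?_⟩
    simp only [LinearMap.comp_apply, LinearEquiv.coe_coe, LinearEquiv.apply_symm_apply]
    congr 1
    change (β ∘ₗ p₁) ∘ₗ i₁ = β
    rw [LinearMap.comp_assoc, h₁, LinearMap.comp_id]
  rw [fittFrac_eq_span S _ hsurj (X := Matrix (Fin N₁) (Fin N₁) R ×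
        Matrix (Fin N₁) (Fin n) R × Matrix (Fin N₁) (Fin N₂) R) fun x =>
      (x.1 * (1 - (i₁ ∘ₗ p₁).toMatrix') + x.2.1 * (j ∘ₗ p₁).toMatrix'
        + x.2.2 * (i₂ ∘ₗ H ∘ₗ p₁).toMatrix').transpose]
  · simp only [Matrix.det_transpose]
  · intro A
    have hrow (l) : (Φ ∘ₗ LinearMap.lcomp R R i₁ ∘ₗ (dotProductEquiv R (Fin N₁)).toLinearMap)
        (fun k => A k l) = 0 ↔ _ :=
      (hker _).trans (dual_comp_section_eq_iff h₁ h₂ H fun k => A k l)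
    simp only [hrow]
    constructor
    · intro h
      choose x y z hxyz using h
      refine ⟨(Matrix.of x, Matrix.of y, Matrix.of z), ?_⟩
      ext k l
      exact congrFun (hxyz l) k
    · rintro ⟨⟨X, Y, Z⟩, rfl⟩ l
      exact ⟨X l, Y l, Z l, rfl⟩

end DualFitting

/-- Let `R` be a commutative noetherian ring with a multiplicative set
`S` of non-zero-divisors, satisfying Assumption (⋆).  For every exact sequence
`0 → M → P₁ → P₂ → N → 0` of finitely generated `S`-torsion modules in `𝓒` with
`pd_R(Pᵢ) ≤ 1`, one has `Fitt_R(P₁)·Fitt_R(N) = Fitt_R(P₂)·Fitt_R(M^*)` as fractional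
ideals, where `M^* = Ext^1_R(M, R)` is computed from any presentation
`0 → K → F → M → 0` with `F` finite free; equivalently, `Fitt⟨-2⟩(M) = Fitt(M^*)` for
every `M ∈ 𝓒`. -/
theorem statement18
    (R : Type) [CommRing R] [IsNoetherianRing R] (S : Submonoid R)
    (hS : S ≤ nonZeroDivisors R) (hstar : AssumptionStar R)
    (M P₁ P₂ Nq : Type) [AddCommGroup M] [Module R M] [AddCommGroup P₁] [Module R P₁]
    [AddCommGroup P₂] [Module R P₂] [AddCommGroup Nq] [Module R Nq]
    (hM : MemC R S M) (hP₁ : MemC R S P₁) (hP₂ : MemC R S P₂) (hN : MemC R S Nq)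
    (hpd₁ : PdLE R 1 P₁) (hpd₂ : PdLE R 1 P₂)
    (f : M →ₗ[R] P₁) (g : P₁ →ₗ[R] P₂) (h : P₂ →ₗ[R] Nq)
    (hf : Function.Injective f) (hfg : Function.Exact f g) (hgh : Function.Exact g h)
    (hh : Function.Surjective h)
    (k : ℕ) (K : Type) [AddCommGroup K] [Module R K]
    (ι : K →ₗ[R] (Fin k → R)) (π : (Fin k → R) →ₗ[R] M)
    (hι : Function.Injective ι) (hπ : Function.Surjective π) (hex : Function.Exact ι π) :
    fittFrac R S P₁ * fittFrac R S Nq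
      = fittFrac R S P₂ * fittFrac R S (ExtOneDualComm R ι) := by

  have := hP₁.1.1
  have := hP₂.1.1
  obtain ⟨n, N₁, π₁, p₁, i₁, hπ₁, hproj₁, h₁⟩ := hpd₁.exists_split_presentation
  obtain ⟨m, N₂, π₂, p₂, i₂, hπ₂, hproj₂, h₂⟩ := hpd₂.exists_split_presentation
  obtain ⟨C₁, hBC₁, hCB₁⟩ := exists_localized_inverse hP₁.1.2 h₁
  obtain ⟨C₂, hBC₂, hCB₂⟩ := exists_localized_inverse hP₂.1.2 h₂
  obtain ⟨G, hG⟩ := Module.projective_lifting_property π₂ (g ∘ₗ π₁) hπ₂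
  replace hG (x) : π₂ (G x) = g (π₁ x) := LinearMap.congr_fun hG x
  obtain ⟨H, hH⟩ := LinearMap.exists_eq_subtype_comp (LinearMap.ker π₂)
    (G ∘ₗ (LinearMap.ker π₁).subtype) fun x => by
      rw [LinearMap.mem_ker, LinearMap.comp_apply, hG, Submodule.subtype_apply,
        LinearMap.mem_ker.1 x.2, map_zero]
  obtain ⟨Φ, hΦ, hker⟩ := exists_dual_presentation hf hfg hgh hh hN.2 hι hπ hex hπ₁ hπ₂ hG hH
  have hGB : G.toMatrix' * ((LinearMap.ker π₁).subtype ∘ₗ p₁).toMatrix'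
      = ((LinearMap.ker π₂).subtype ∘ₗ p₂).toMatrix' * (i₂ ∘ₗ H ∘ₗ p₁).toMatrix' := by
    rw [← LinearMap.toMatrix'_comp, ← LinearMap.toMatrix'_comp]
    congr 1
    refine LinearMap.ext fun x => ?_
    have := LinearMap.congr_fun h₂ (H (p₁ x))
    simp only [LinearMap.comp_apply, LinearMap.id_apply] at this
    simp [this, hH]
  have hEH : (i₂ ∘ₗ p₂).toMatrix' * (i₂ ∘ₗ H ∘ₗ p₁).toMatrix' = (i₂ ∘ₗ H ∘ₗ p₁).toMatrix' := by
    rw [← LinearMap.toMatrix'_comp, LinearMap.comp_assoc, ← LinearMap.comp_assoc _ _ p₂, h₂,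
      LinearMap.id_comp]
  have hX : C₂ * G.toMatrix'.map (algebraMap R (Localization S))
      * ((LinearMap.ker π₁).subtype ∘ₗ p₁).toMatrix'.map (algebraMap R (Localization S))
      = (i₂ ∘ₗ H ∘ₗ p₁).toMatrix'.map (algebraMap R (Localization S)) := by
    rw [Matrix.mul_assoc, ← Matrix.map_mul, hGB, Matrix.map_mul, ← Matrix.mul_assoc, hCB₂,
      ← Matrix.map_mul, hEH]
  rw [fittFrac_eq_colDetSpan S hπ₁ h₁, fittFrac_eq_colDetSpan S hπ₂ h₂,
    fittFrac_eq_span_mul_add S hπ₂ h₂ hgh hh hπ₁ hG, span_det_mul_add_eq _ C₂ _ _ hBC₂ hCB₂,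
    fittFrac_eq_span_syzygy S h₁ h₂ hΦ hker, span_det_syzygy_eq _ C₁ _ _ _ hBC₁ hCB₁ hX,
    mul_left_comm]
end

section
/- Let p be a prime, d ≥ 1, Λ = ℤ_p[[T_1, …, T_d]], Δ a finite group, R = Λ[Δ] the group ring (Λ central in R), and S = Λ ∖ {0}. Then every finitely generated left R-module P which is S-torsion and has pd_R(P) ≤ 1 admits a quadratic presentation, i.e., there is an exact sequence of left R-modules 0 → R^a → R^a → P → 0 for some a ≥ 0. -/
open CategoryTheory MulOpposite

/-- The Iwasawa algebra `Λ = ℤ_p[[T₁, …, T_d]]`. -/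
abbrev PSL (p d : ℕ) [Fact p.Prime] : Type := MvPowerSeries (Fin d) ℤ_[p]

universe u

section
variable {R : Type*} [Ring R]

theorem Submodule.eq_top_of_sup_eq_top_of_le_jacobson {M : Type*} [AddCommGroup M] [Module R M]
    [Module.Finite R M] {N K : Submodule R M} (hK : K ≤ Module.jacobson R M) (h : N ⊔ K = ⊤) :
    N = ⊤ := by
  by_contra hN
  obtain ⟨m, hm, hNm⟩ := (eq_top_or_exists_le_coatom N).resolve_left hN
  exact hm.1 (top_le_iff.mp (h ▸ sup_le hNm (hK.trans (sInf_le hm))))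

/-- Uniqueness of projective covers. -/
theorem Module.nonempty_linearEquiv_of_projective_cover {P P' X : Type*}
    [AddCommGroup P] [Module R P] [AddCommGroup P'] [Module R P'] [AddCommGroup X] [Module R X]
    [Module.Projective R P] [Module.Projective R P'] [Module.Finite R P] [Module.Finite R P']
    (π : P →ₗ[R] X) (π' : P' →ₗ[R] X) (hπ : Function.Surjective π) (hπ' : Function.Surjective π')
    (hk : LinearMap.ker π ≤ Module.jacobson R P) (hk' : LinearMap.ker π' ≤ Module.jacobson R P') :
    Nonempty (P ≃ₗ[R] P') := by
  obtain ⟨f, hf⟩ := Module.projective_lifting_property π' π hπ'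
  have hf' (x : P) : π' (f x) = π x := LinearMap.congr_fun hf x
  have hfs : LinearMap.range f = ⊤ := by
    refine Submodule.eq_top_of_sup_eq_top_of_le_jacobson hk' (eq_top_iff.mpr fun y _ => ?_)
    obtain ⟨x, hx⟩ := hπ (π' y)
    refine Submodule.mem_sup.mpr ⟨f x, ⟨x, rfl⟩, y - f x, ?_, by abel⟩
    simp [hf', hx]
  obtain ⟨g, hg⟩ := Module.projective_lifting_property f LinearMap.id (LinearMap.range_eq_top.mp hfs)
  have hg' (y : P') : f (g y) = y := LinearMap.congr_fun hg y
  have hgs : LinearMap.range g = ⊤ := by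
    have hkf : LinearMap.ker f ≤ Module.jacobson R P := by
      refine le_trans (fun x hx => ?_) hk
      rw [LinearMap.mem_ker] at hx ⊢
      rw [← hf', hx, map_zero]
    refine Submodule.eq_top_of_sup_eq_top_of_le_jacobson hkf (eq_top_iff.mpr fun x _ => ?_)
    refine Submodule.mem_sup.mpr ⟨g (f x), ⟨f x, rfl⟩, x - g (f x), ?_, by abel⟩
    simp [hg']
  have hgi : Function.Injective g := Function.LeftInverse.injective hg'
  exact ⟨(LinearEquiv.ofBijective g ⟨hgi, LinearMap.range_eq_top.mp hgs⟩).symm⟩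

/-- Cyclicity of the Hattori-Stallings trace computed in finite dual bases. -/
theorem sum_tracial_dualBasis_comm {W : Type*} [AddCommGroup W] (U : R →+ W)
    (hU : ∀ a b, U (a * b) = U (b * a)) {M N ι κ : Type*} [AddCommGroup M] [Module R M]
    [AddCommGroup N] [Module R N] [Fintype ι] [Fintype κ]
    (x : ι → M) (φ : ι → M →ₗ[R] R) (hx : ∀ m, ∑ i, φ i m • x i = m)
    (y : κ → N) (ψ : κ → N →ₗ[R] R) (hy : ∀ n, ∑ j, ψ j n • y j = n)
    (f : M →ₗ[R] N) (g : N →ₗ[R] M) :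
    ∑ i, U (φ i (g (f (x i)))) = ∑ j, U (ψ j (f (g (y j)))) := by
  have h₁ (i : ι) : U (φ i (g (f (x i)))) = ∑ j, U (ψ j (f (x i)) * φ i (g (y j))) := by
    conv_lhs => rw [← hy (f (x i))]
    simp
  have h₂ (j : κ) : U (ψ j (f (g (y j)))) = ∑ i, U (φ i (g (y j)) * ψ j (f (x i))) := by
    conv_lhs => rw [← hx (g (y j))]
    simp
  simp_rw [h₁, h₂]
  rw [Finset.sum_comm]
  exact Finset.sum_congr rfl fun j _ => Finset.sum_congr rfl fun i _ => hU _ _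

theorem smul_eq_zero_of_mem_jacobson {X : Type*} [AddCommGroup X] [Module R X]
    [IsSimpleModule R X] {r : R} (hr : r ∈ Ring.jacobson R) (x : X) : r • x = 0 := by
  have h := Ring.jacobson_smul_top_le (R := R) (M := X)
    (Submodule.smul_mem_smul hr (Submodule.mem_top (x := x)))
  rwa [IsSemisimpleModule.jacobson_eq_bot R X, Submodule.mem_bot] at h

/-- The idempotent `ε`, together with `ε • x = x ≠ 0`, exhibits `R ε` as a projective cover of
the simple module `X`. -/
structure IsCoverIdempotent {X : Type*} [AddCommGroup X] [Module R X] (ε : R) (x : X) : Prop where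
  isIdempotentElem : IsIdempotentElem ε
  smul_eq : ε • x = x
  ne_zero : x ≠ 0
  mul_mem : ∀ r : R, r • x = 0 → r * ε ∈ Ring.jacobson R

theorem exists_isCoverIdempotent [IsSemisimpleModule R (R ⧸ Ring.jacobson R)]
    (hlift : ∀ e : R ⧸ Ring.jacobson R, IsIdempotentElem e →
      ∃ ε : R, IsIdempotentElem ε ∧ Ideal.Quotient.mk _ ε = e)
    (X : Type*) [AddCommGroup X] [Module R X] [IsSimpleModule R X] :
    ∃ (ε : R) (x : X), IsCoverIdempotent ε x := by
  have := IsSimpleModule.nontrivial R X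
  obtain ⟨x, hx⟩ := exists_ne (0 : X)
  let q : (R ⧸ Ring.jacobson R) →ₗ[R] X :=
    Submodule.liftQ _ (LinearMap.toSpanSingleton R X x)
      fun r hr => smul_eq_zero_of_mem_jacobson hr x
  have hq (r : R) : q (Ideal.Quotient.mk _ r) = r • x := rfl
  have hqs : Function.Surjective q := fun y => by
    obtain ⟨r, rfl⟩ := IsSimpleModule.toSpanSingleton_surjective R hx y
    exact ⟨Ideal.Quotient.mk _ r, rfl⟩
  obtain ⟨s, hs⟩ := IsSemisimpleModule.lifting_property q hqs LinearMap.id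
  have hs' (y : X) : q (s y) = y := LinearMap.congr_fun hs y
  have hmul (r : R) (z : R ⧸ Ring.jacobson R) : r • z = Ideal.Quotient.mk _ r * z := rfl
  obtain ⟨e, he⟩ := Ideal.Quotient.mk_surjective (s x)
  have hex : e • x = x := by rw [← hq, he, hs']
  obtain ⟨ε, hε, hεe⟩ := hlift (s x) <| by
    change s x * s x = s x
    nth_rewrite 1 [← he]
    rw [← hmul, ← map_smul, hex]
  refine ⟨ε, x, hε, ?_, hx, fun r hr => ?_⟩
  · rw [← hq, hεe, hs']
  · rw [← Ideal.Quotient.eq_zero_iff_mem, map_mul, hεe, ← hmul, ← map_smul, hr, map_zero]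

namespace IsCoverIdempotent

variable {X : Type*} [AddCommGroup X] [Module R X] [IsSimpleModule R X] {ε : R} {x : X}

theorem exists_linearMap (h : IsCoverIdempotent ε x) {Y : Type*} [AddCommGroup Y] [Module R Y]
    [IsSimpleModule R Y] {y : Y} (hy : ε • y = y) : ∃ f : X →ₗ[R] Y, f x = y := by
  have hs := IsSimpleModule.toSpanSingleton_surjective R h.ne_zero
  have hk : LinearMap.ker (LinearMap.toSpanSingleton R X x) ≤
      LinearMap.ker (LinearMap.toSpanSingleton R Y y) := fun r hr => by
    rw [LinearMap.mem_ker, LinearMap.toSpanSingleton_apply] at hr ⊢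
    rw [← hy, smul_smul]
    exact smul_eq_zero_of_mem_jacobson (h.mul_mem r hr) y
  refine ⟨Submodule.liftQ _ _ hk ∘ₗ
    (LinearMap.quotKerEquivOfSurjective _ hs).symm.toLinearMap, ?_⟩
  have : (LinearMap.quotKerEquivOfSurjective _ hs).symm x = Submodule.Quotient.mk 1 := by
    rw [LinearEquiv.symm_apply_eq]
    simp
  simp [this]

theorem exists_cover (h : IsCoverIdempotent ε x) :
    ∃ π : Ideal.span {ε} →ₗ[R] X, Function.Surjective π ∧
      LinearMap.ker π ≤ Module.jacobson R (Ideal.span {ε}) := by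
  refine ⟨LinearMap.toSpanSingleton R X x ∘ₗ (Ideal.span {ε}).subtype, fun y => ?_, ?_⟩
  · obtain ⟨r, rfl⟩ := IsSimpleModule.toSpanSingleton_surjective R h.ne_zero y
    refine ⟨⟨r * ε, Ideal.mul_mem_left _ _ (Ideal.mem_span_singleton_self ε)⟩, ?_⟩
    simp [mul_smul, h.smul_eq]
  · rintro ⟨r, hr⟩ hrx
    obtain ⟨a, rfl⟩ := Ideal.mem_span_singleton'.mp hr
    have hrx' : (a * ε) • x = 0 := hrx
    have hm := h.mul_mem _ hrx'
    have he : (⟨a * ε, hr⟩ : Ideal.span {ε}) =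
        (a * ε * ε) • ⟨ε, Ideal.mem_span_singleton_self ε⟩ := by
      ext
      simp [mul_assoc, h.isIdempotentElem.eq]
    rw [he]
    exact Ring.jacobson_smul_top_le _ _ (Submodule.smul_mem_smul hm Submodule.mem_top)

theorem _root_.IsIdempotentElem.sum_smul_span {ε : R} (hε : IsIdempotentElem ε)
    (m : Ideal.span {ε}) :
    (Ideal.span {ε}).subtype m • (⟨ε, Ideal.mem_span_singleton_self ε⟩ : Ideal.span {ε}) = m := by
  obtain ⟨r, hr⟩ := m
  obtain ⟨a, rfl⟩ := Ideal.mem_span_singleton'.mp hr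
  ext
  simp [mul_assoc, hε.eq]

theorem _root_.IsIdempotentElem.projective_span {ε : R} (hε : IsIdempotentElem ε) :
    Module.Projective R (Ideal.span {ε}) :=
  .of_split (Ideal.span {ε}).subtype
    (LinearMap.toSpanSingleton R _ ⟨ε, Ideal.mem_span_singleton_self ε⟩)
    (LinearMap.ext hε.sum_smul_span)

end IsCoverIdempotent

/-- The trace of the action of `R` on a finite simple module, over its endomorphism field. -/
theorem exists_tracial_of_isSimpleModule (X : Type u) [AddCommGroup X] [Module R X]
    [IsSimpleModule R X] [Finite X] (p : ℕ) [Fact p.Prime] (hp : (p : R) ∈ Ring.jacobson R) :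
    ∃ (F : Type u) (_ : Field F) (_ : CharP F p) (t : R →+ F), (∀ a b, t (a * b) = t (b * a)) ∧
      (∀ (ε : R) (x : X), IsCoverIdempotent ε x → t ε = 1) ∧
      (∀ ε : R, (∀ y : X, ε • y = 0) → t ε = 0) := by
  classical
  have := IsSimpleModule.nontrivial R X
  have : Finite (Module.End R X) := Finite.of_injective _ DFunLike.coe_injective
  let _ : Field (Module.End R X) := littleWedderburn _
  have hchar : CharP (Module.End R X) p := by
    refine (CharP.charP_iff_prime_eq_zero Fact.out).mpr (LinearMap.ext fun y => ?_)
    have h := smul_eq_zero_of_mem_jacobson hp y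
    rw [Nat.cast_smul_eq_nsmul] at h
    exact h
  let ρ : R →+* Module.End (Module.End R X) X := Module.toModuleEnd (Module.End R X) X
  refine ⟨Module.End R X, inferInstance, hchar,
    (LinearMap.trace (Module.End R X) X).toAddMonoidHom.comp ρ.toAddMonoidHom, fun a b => ?_,
    fun ε x h => ?_, fun ε h => ?_⟩
  · change LinearMap.trace _ X (ρ (a * b)) = LinearMap.trace _ X (ρ (b * a))
    rw [map_mul ρ, map_mul ρ, LinearMap.trace_mul_comm]
  · change LinearMap.trace _ X (ρ ε) = 1
    have hproj : LinearMap.IsProj (Submodule.span (Module.End R X) {x}) (ρ ε) := by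
      constructor
      · intro y
        obtain ⟨f, hf⟩ := h.exists_linearMap (y := ε • y)
          (by rw [smul_smul, h.isIdempotentElem.eq])
        exact Submodule.mem_span_singleton.mpr ⟨f, hf⟩
      · intro y hy
        obtain ⟨f, rfl⟩ := Submodule.mem_span_singleton.mp hy
        change ε • f x = f x
        rw [← map_smul, h.smul_eq]
    rw [hproj.trace, finrank_span_singleton h.ne_zero, Nat.cast_one]
  · change LinearMap.trace _ X (ρ ε) = 0
    have : ρ ε = 0 := LinearMap.ext h
    rw [this, map_zero]

variable (R) in
/-- The additive subgroup generated by the additive commutators of a ring. -/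
def addCommutators : AddSubgroup R :=
  AddSubgroup.closure {z | ∃ a b : R, z = a * b - b * a}

theorem mul_sub_mul_mem_addCommutators (a b : R) : a * b - b * a ∈ addCommutators R :=
  AddSubgroup.subset_closure ⟨a, b, rfl⟩

theorem addCommutators_le_ker {W : Type*} [AddCommGroup W] (t : R →+ W)
    (ht : ∀ a b, t (a * b) = t (b * a)) : addCommutators R ≤ t.ker := by
  refine (AddSubgroup.closure_le _).mpr ?_
  rintro _ ⟨a, b, rfl⟩
  simp [AddMonoidHom.mem_ker, ht a b]

section Independence

variable {ι : Type*} [Fintype ι] {X : ι → Type u} [∀ i, AddCommGroup (X i)]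
  [∀ i, Module R (X i)] [∀ i, IsSimpleModule R (X i)] [∀ i, Finite (X i)]
  {ε : ι → R} {x : ∀ i, X i}

theorem dvd_of_sum_zsmul_mem_addCommutators (hcov : ∀ i, IsCoverIdempotent (ε i) (x i))
    (hX : ∀ i j, i ≠ j → IsEmpty (X i ≃ₗ[R] X j)) (p : ℕ) [Fact p.Prime]
    (hp : (p : R) ∈ Ring.jacobson R) (c : ι → ℤ) (hc : ∑ i, c i • ε i ∈ addCommutators R)
    (j : ι) : (p : ℤ) ∣ c j := by
  classical
  obtain ⟨F, _, _, t, ht, ht₁, ht₀⟩ := exists_tracial_of_isSimpleModule (R := R) (X j) p hp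
  have h : t (∑ i, c i • ε i) = 0 := addCommutators_le_ker t ht hc
  have hij (i : ι) (hne : i ≠ j) : t (ε i) = 0 := by
    refine ht₀ _ fun y => ?_
    by_contra hy
    obtain ⟨f, hf⟩ := (hcov i).exists_linearMap (y := ε i • y)
      (by rw [smul_smul, (hcov i).isIdempotentElem.eq])
    have hf0 : f ≠ 0 := by
      rintro rfl
      exact hy hf.symm
    exact (hX i j hne).false (.ofBijective f (LinearMap.bijective_of_ne_zero hf0))
  rw [map_sum, Finset.sum_eq_single j (fun i _ hne => by rw [map_zsmul, hij i hne, smul_zero])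
    (by simp), map_zsmul, ht₁ _ _ (hcov j), zsmul_one] at h
  exact (CharP.intCast_eq_zero_iff F p _).mp h

theorem eq_zero_of_sum_zsmul_mem_addCommutators (hcov : ∀ i, IsCoverIdempotent (ε i) (x i))
    (hX : ∀ i j, i ≠ j → IsEmpty (X i ≃ₗ[R] X j)) (p : ℕ) [hpp : Fact p.Prime]
    (hp : (p : R) ∈ Ring.jacobson R)
    (htf : ∀ z : R, p • z ∈ addCommutators R → z ∈ addCommutators R)
    (c : ι → ℤ) (hc : ∑ i, c i • ε i ∈ addCommutators R) (j : ι) : c j = 0 := by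
  have key (n : ℕ) : ∀ c : ι → ℤ, ∑ i, c i • ε i ∈ addCommutators R → (p : ℤ) ^ n ∣ c j := by
    induction n with
    | zero => simp
    | succ n ih =>
      intro c hc
      choose b hb using dvd_of_sum_zsmul_mem_addCommutators hcov hX p hp c hc
      have hbc : ∑ i, b i • ε i ∈ addCommutators R := by
        refine htf _ ?_
        convert hc using 1
        rw [Finset.smul_sum]
        refine Finset.sum_congr rfl fun i _ => ?_
        rw [hb i, mul_smul, natCast_zsmul]
      rw [hb j, pow_succ']
      exact mul_dvd_mul_left _ (ih b hbc)
  refine Int.eq_zero_of_abs_lt_dvd (key (c j).natAbs c hc) ?_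
  rw [Int.abs_eq_natAbs]
  exact_mod_cast Nat.lt_pow_self hpp.out.one_lt

end Independence

theorem isSemisimpleModule_quotient_jacobson [IsSemisimpleRing (R ⧸ Ring.jacobson R)]
    (M : Type*) [AddCommGroup M] [Module R M] :
    IsSemisimpleModule R (M ⧸ Module.jacobson R M) := by
  have hM : Module.IsTorsionBySet R (M ⧸ Module.jacobson R M) (Ring.jacobson R) := by
    rintro m ⟨r, hr⟩
    have h := Ring.jacobson_smul_top_le _ (M ⧸ Module.jacobson R M)
      (Submodule.smul_mem_smul hr (Submodule.mem_top (x := m)))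
    rwa [Module.jacobson_quotient_jacobson, Submodule.mem_bot] at h
  let _ := hM.module
  exact hM.isSemisimpleModule_iff.mp inferInstance

theorem exists_linearEquiv_submodule_quotient_jacobson
    [IsSemisimpleModule R (R ⧸ Ring.jacobson R)]
    (S : Type*) [AddCommGroup S] [Module R S] [IsSimpleModule R S] :
    ∃ T : Submodule R (R ⧸ Ring.jacobson R), Nonempty (S ≃ₗ[R] T) := by
  have := IsSimpleModule.nontrivial R S
  obtain ⟨s, hs⟩ := exists_ne (0 : S)
  let q : (R ⧸ Ring.jacobson R) →ₗ[R] S :=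
    Submodule.liftQ _ (LinearMap.toSpanSingleton R S s)
      fun r hr => smul_eq_zero_of_mem_jacobson hr s
  refine LinearMap.linearEquiv_of_ne_zero (f := q) fun h => hs ?_
  have h₁ : q (Submodule.Quotient.mk 1) = (1 : R) • s := rfl
  rwa [h, one_smul, LinearMap.zero_apply, eq_comm] at h₁

theorem exists_linearEquiv_pi_span [IsSemisimpleRing (R ⧸ Ring.jacobson R)]
    {ι : Type*} {X : ι → Type*} [∀ i, AddCommGroup (X i)] [∀ i, Module R (X i)]
    [∀ i, IsSimpleModule R (X i)] {ε : ι → R} {x : ∀ i, X i}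
    (hcov : ∀ i, IsCoverIdempotent (ε i) (x i))
    (M : Type*) [AddCommGroup M] [Module R M] [Module.Finite R M] [Module.Projective R M]
    (hX : ∀ N : Submodule R (M ⧸ Module.jacobson R M), IsSimpleModule R N →
      ∃ i, Nonempty (N ≃ₗ[R] X i)) :
    ∃ (n : ℕ) (f : Fin n → ι), Nonempty (M ≃ₗ[R] ∀ k, Ideal.span {ε (f k)}) := by
  have := isSemisimpleModule_quotient_jacobson (R := R) M
  obtain ⟨n, S, e, hS⟩ :=
    IsSemisimpleModule.exists_linearEquiv_fin_dfinsupp R (M ⧸ Module.jacobson R M)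
  choose f g using fun k => hX (S k) (hS k)
  let e' : (M ⧸ Module.jacobson R M) ≃ₗ[R] ∀ k, X (f k) :=
    (e.trans (DFinsupp.linearEquivFunOnFintype (R := R))).trans
      (LinearEquiv.piCongrRight fun k => (g k).some)
  choose π hπ hπk using fun i => (hcov i).exists_cover
  have (k : Fin n) := (hcov (f k)).isIdempotentElem.projective_span
  have : Module.Projective R (∀ k, Ideal.span {ε (f k)}) :=
    .of_equiv (DFinsupp.linearEquivFunOnFintype (R := R))
  refine ⟨n, f, Module.nonempty_linearEquiv_of_projective_cover
    (e'.toLinearMap ∘ₗ (Module.jacobson R M).mkQ)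
    (LinearMap.pi fun k => π (f k) ∘ₗ LinearMap.proj k)
    (e'.surjective.comp (Submodule.mkQ_surjective _)) (fun y => ?_) (fun m hm => ?_)
    fun m hm => ?_⟩
  · choose z hz using fun k => hπ (f k) (y k)
    exact ⟨z, funext hz⟩
  · simpa using hm
  · have hmk (k : Fin n) : m k ∈ Module.jacobson R (Ideal.span {ε (f k)}) :=
      hπk (f k) (congr_fun hm k)
    rw [← Finset.univ_sum_single m]
    exact Submodule.sum_mem _ fun k _ =>
      Module.map_jacobson_le (LinearMap.single R _ k) (Submodule.mem_map_of_mem (hmk k))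

/-- Rank of a product of modules `R ε`, modulo additive commutators. -/
theorem sum_dualBasis_sub_sum_mem_addCommutators {ι κ : Type*} [Fintype ι] [Fintype κ]
    {ε : κ → R} (hε : ∀ k, IsIdempotentElem (ε k))
    {M : Type*} [AddCommGroup M] [Module R M]
    (x : ι → M) (φ : ι → M →ₗ[R] R) (hx : ∀ m, ∑ i, φ i m • x i = m)
    (e : M ≃ₗ[R] ∀ k, Ideal.span {ε k}) :
    ∑ i, φ i (x i) - ∑ k, ε k ∈ addCommutators R := by
  classical
  let U := QuotientAddGroup.mk' (addCommutators R)
  have hU (a b : R) : U (a * b) = U (b * a) := by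
    rw [← sub_eq_zero, ← map_sub]
    exact (QuotientAddGroup.eq_zero_iff _).mpr (mul_sub_mul_mem_addCommutators a b)
  have h := sum_tracial_dualBasis_comm U hU x φ hx
    (fun k => Pi.single k (⟨ε k, Ideal.mem_span_singleton_self _⟩ : Ideal.span {ε k}))
    (fun k => (Ideal.span {ε k}).subtype ∘ₗ LinearMap.proj k) (fun m => by
      conv_rhs => rw [← Finset.univ_sum_single m]
      refine Finset.sum_congr rfl fun k _ => ?_
      rw [← Pi.single_smul]
      exact congr_arg _ ((hε k).sum_smul_span (m k))) e.toLinearMap e.symm.toLinearMap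
  refine (QuotientAddGroup.eq_zero_iff _).mp (?_ : U _ = 0)
  simpa [sub_eq_zero] using h

/-- Projective modules over suitable semiperfect rings are determined by their ranks modulo
additive commutators. -/
theorem nonempty_linearEquiv_of_sum_dualBasis_sub_mem [Finite (R ⧸ Ring.jacobson R)]
    (hlift : ∀ e : R ⧸ Ring.jacobson R, IsIdempotentElem e →
      ∃ ε : R, IsIdempotentElem ε ∧ Ideal.Quotient.mk _ ε = e)
    (p : ℕ) [Fact p.Prime] (hp : (p : R) ∈ Ring.jacobson R)
    (htf : ∀ z : R, p • z ∈ addCommutators R → z ∈ addCommutators R)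
    {M N : Type*} [AddCommGroup M] [Module R M] [Module.Finite R M] [Module.Projective R M]
    [AddCommGroup N] [Module R N] [Module.Finite R N] [Module.Projective R N]
    {ι κ : Type*} [Fintype ι] [Fintype κ]
    (x : ι → M) (φ : ι → M →ₗ[R] R) (hx : ∀ m, ∑ i, φ i m • x i = m)
    (y : κ → N) (ψ : κ → N →ₗ[R] R) (hy : ∀ n, ∑ j, ψ j n • y j = n)
    (h : ∑ i, φ i (x i) - ∑ j, ψ j (y j) ∈ addCommutators R) : Nonempty (M ≃ₗ[R] N) := by
  classical
  have : IsSemisimpleRing (R ⧸ Ring.jacobson R) :=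
    IsArtinianRing.isSemisimpleRing_iff_jacobson.mpr (Ring.jacobson_quotient_jacobson R)
  have : IsSemisimpleModule R (R ⧸ Ring.jacobson R) := isSemisimpleModule_quotient_jacobson R
  let iso : Setoid {S : Submodule R (R ⧸ Ring.jacobson R) // IsSimpleModule R S} :=
    { r := fun S T => Nonempty (S.1 ≃ₗ[R] T.1)
      iseqv := ⟨fun S => ⟨.refl R _⟩, fun ⟨e⟩ => ⟨e.symm⟩, fun ⟨e⟩ ⟨e'⟩ => ⟨e.trans e'⟩⟩ }
  have : Finite (Submodule R (R ⧸ Ring.jacobson R)) :=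
    Finite.of_injective _ SetLike.coe_injective
  have := Fintype.ofFinite (Quotient iso)
  let X (i : Quotient iso) : Submodule R (R ⧸ Ring.jacobson R) := i.out.1
  have hXs (i : Quotient iso) : IsSimpleModule R (X i) := i.out.2
  have hXne (i j : Quotient iso) (hij : i ≠ j) : IsEmpty (X i ≃ₗ[R] X j) :=
    ⟨fun e => hij (by rw [← i.out_eq, ← j.out_eq]; exact Quotient.sound ⟨e⟩)⟩
  have hmk (T : Submodule R (R ⧸ Ring.jacobson R)) (hT : IsSimpleModule R T) :
      Nonempty (X (Quotient.mk iso ⟨T, hT⟩) ≃ₗ[R] T) := Quotient.mk_out (s := iso) ⟨T, hT⟩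
  choose ε x' hcov using fun i => exists_isCoverIdempotent hlift (X i)
  have hXex (S : Submodule R (M ⧸ Module.jacobson R M)) (_ : IsSimpleModule R S) :
      ∃ i, Nonempty (S ≃ₗ[R] X i) := by
    obtain ⟨T, ⟨e⟩⟩ := exists_linearEquiv_submodule_quotient_jacobson (R := R) S
    obtain ⟨e'⟩ := hmk T (IsSimpleModule.congr e.symm)
    exact ⟨_, ⟨e.trans e'.symm⟩⟩
  have hXex' (S : Submodule R (N ⧸ Module.jacobson R N)) (_ : IsSimpleModule R S) :
      ∃ i, Nonempty (S ≃ₗ[R] X i) := by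
    obtain ⟨T, ⟨e⟩⟩ := exists_linearEquiv_submodule_quotient_jacobson (R := R) S
    obtain ⟨e'⟩ := hmk T (IsSimpleModule.congr e.symm)
    exact ⟨_, ⟨e.trans e'.symm⟩⟩
  obtain ⟨m, f, ⟨eM⟩⟩ := exists_linearEquiv_pi_span hcov M hXex
  obtain ⟨n, g, ⟨eN⟩⟩ := exists_linearEquiv_pi_span hcov N hXex'
  have hM := sum_dualBasis_sub_sum_mem_addCommutators
    (fun k => (hcov (f k)).isIdempotentElem) x φ hx eM
  have hN := sum_dualBasis_sub_sum_mem_addCommutators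
    (fun k => (hcov (g k)).isIdempotentElem) y ψ hy eN
  have hcount {l : ℕ} (f : Fin l → Quotient iso) :
      ∑ k, ε (f k) = ∑ i, (Fintype.card {k // f k = i} : ℤ) • ε i := by
    rw [← Finset.sum_fiberwise Finset.univ f]
    refine Finset.sum_congr rfl fun i _ => ?_
    rw [Finset.sum_congr rfl fun k hk => by rw [(Finset.mem_filter.mp hk).2], Finset.sum_const,
      Fintype.card_subtype, natCast_zsmul]
  have hfg : ∑ i, ((Fintype.card {k // f k = i} : ℤ) - Fintype.card {k // g k = i}) • ε i ∈
      addCommutators R := by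
    simp_rw [sub_smul]
    rw [Finset.sum_sub_distrib, ← hcount, ← hcount]
    convert sub_mem (add_mem h hN) hM using 1
    abel
  have hcard (i : Quotient iso) : Fintype.card {k // f k = i} = Fintype.card {k // g k = i} := by
    have := eq_zero_of_sum_zsmul_mem_addCommutators hcov hXne p hp htf _ hfg i
    omega
  let σ : Fin m ≃ Fin n := Equiv.ofFiberEquiv fun i => Fintype.equivOfCardEq (hcard i)
  have hσ (k : Fin m) : g (σ k) = f k := Equiv.ofFiberEquiv_map _ k
  exact ⟨eM.trans ((LinearEquiv.piCongrRight fun k =>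
    LinearEquiv.ofEq _ _ (by rw [hσ k])).trans
      ((LinearEquiv.piCongrLeft R (fun k => Ideal.span {ε (g k)}) σ).trans eN.symm))⟩

end

namespace MonoidAlgebra

variable {A G : Type*} [CommRing A] [Group G]

theorem mem_addCommutators_of_smul_mem [NoZeroDivisors A] {s : A} (hs : s ≠ 0)
    {z : MonoidAlgebra A G} (h : s • z ∈ addCommutators (MonoidAlgebra A G)) :
    z ∈ addCommutators (MonoidAlgebra A G) := by
  let r (g : G) : G := (ConjClasses.mk g).out
  have hr (g h : G) : r (g * h) = r (h * g) := by
    refine congrArg Quotient.out (ConjClasses.mk_eq_mk_iff_isConj.mpr ?_)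
    exact isConj_iff.mpr ⟨h, by group⟩
  let U : MonoidAlgebra A G →ₗ[A] MonoidAlgebra A G := mapDomainLinearMap A A r
  have hU (a b : MonoidAlgebra A G) : U (a * b) = U (b * a) := by
    induction a using induction_linear with
    | zero => simp
    | add a a' ha ha' => simp [add_mul, mul_add, ha, ha']
    | single g a =>
      induction b using induction_linear with
      | zero => simp
      | add b b' hb hb' => simp only [add_mul, mul_add, map_add, hb, hb']
      | single h b => simp [U, single_mul_single, hr g h, mul_comm a b]
  have hsub (x : MonoidAlgebra A G) : x - U x ∈ addCommutators (MonoidAlgebra A G) := by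
    induction x using induction_linear with
    | zero => simp
    | add a a' ha ha' =>
      rw [map_add, add_sub_add_comm]
      exact add_mem ha ha'
    | single g a =>
      have hconj : IsConj (r g) g :=
        ConjClasses.mk_eq_mk_iff_isConj.mp (Quotient.out_eq (ConjClasses.mk g))
      obtain ⟨c, hc⟩ := isConj_iff.mp hconj
      have := mul_sub_mul_mem_addCommutators (R := MonoidAlgebra A G)
        (single (c * r g) a) (single c⁻¹ 1)
      simpa [single_mul_single, U, hc] using this
  have h₀ : s • U z = 0 := by
    rw [← map_smul]
    exact addCommutators_le_ker U.toAddMonoidHom hU h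
  have h₁ : U z = 0 := by
    ext g
    have := congrArg (fun w => w.coeff g) h₀
    simpa [hs] using this
  simpa [h₁] using hsub z

theorem mapRingHom_surjective {k : Type*} [CommRing k] {f : A →+* k}
    (hf : Function.Surjective f) : Function.Surjective (mapRingHom G f) := by
  intro x
  induction x using induction_linear with
  | zero => exact ⟨0, map_zero _⟩
  | add a b ha hb =>
    obtain ⟨a, rfl⟩ := ha
    obtain ⟨b, rfl⟩ := hb
    exact ⟨a + b, map_add _ _ _⟩
  | single g a =>
    obtain ⟨a, rfl⟩ := hf a
    exact ⟨single g a, by simp⟩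

theorem ker_mapRingHom_le_jacobson [IsLocalRing A] {k : Type*} [CommRing k] [Nontrivial k]
    [Finite G] (f : A →+* k) :
    RingHom.ker (mapRingHom G f) ≤ Ring.jacobson (MonoidAlgebra A G) := by
  have hle : RingHom.ker f ≤ (⊥ : Ideal A).jacobson := by
    rw [IsLocalRing.jacobson_eq_maximalIdeal _ bot_ne_top]
    exact IsLocalRing.le_maximalIdeal (RingHom.ker_ne_top f)
  have hker (x : MonoidAlgebra A G) (hx : mapRingHom G f x = 0) :
      x ∈ RingHom.ker f • (⊤ : Submodule A (MonoidAlgebra A G)) := by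
    rw [← x.sum_coeff_single]
    refine Submodule.sum_mem _ fun g _ => ?_
    have hg : x.coeff g ∈ RingHom.ker f := by
      rw [RingHom.mem_ker, ← coeff_mapRingHom, hx]
      rfl
    simpa using Submodule.smul_mem_smul hg (Submodule.mem_top (x := single g (1 : A)))
  refine le_sInf fun N hN => ?_
  by_contra hnot
  have htop : N ⊔ RingHom.ker (mapRingHom G f) = ⊤ :=
    hN.2 _ (lt_of_le_of_ne le_sup_left fun h => hnot (h ▸ le_sup_right))
  refine hN.1 ?_
  have := Submodule.le_of_le_smul_of_le_jacobson_bot (I := RingHom.ker f)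
    (N := N.restrictScalars A) (N' := (⊤ : Submodule A (MonoidAlgebra A G)))
    Module.Finite.fg_top hle fun x _ => ?_
  · exact eq_top_iff.mpr fun x hx => this (Submodule.mem_top (x := x))
  · obtain ⟨y, hy, z, hz, rfl⟩ := Submodule.mem_sup.mp (htop ▸ Submodule.mem_top (x := x))
    exact Submodule.add_mem_sup hy (hker z hz)

end MonoidAlgebra

theorem exists_isIdempotentElem_sub_eq_smul {A B : Type*} [CommRing A] [Ring B] [Algebra A B]
    (π : A) [IsAdicComplete (Ideal.span {π}) B] (y : B) (hy : ∃ z, y * y - y = π • z) :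
    ∃ ε : B, IsIdempotentElem ε ∧ ∃ z, ε - y = π • z := by
  have hmem (n : ℕ) (x : B) :
      x ∈ (Ideal.span {π} ^ n • ⊤ : Submodule A B) ↔ ∃ z, x = π ^ n • z := by
    rw [Ideal.span_singleton_pow, Submodule.ideal_span_singleton_smul,
      Submodule.mem_smul_pointwise_iff_exists]
    simp [eq_comm]
  let h (x : B) : B := 3 * x ^ 2 - 2 * x ^ 3
  have hh (x : B) : h x * h x - h x = (x * x - x) * ((x * x - x) * (4 * x ^ 2 - 4 * x - 3)) := by
    simp only [h]
    noncomm_ring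
  have hsub (x : B) : h x - x = (x * x - x) * (1 - 2 * x) := by
    simp only [h]
    noncomm_ring
  let s (n : ℕ) : B := h^[n] y
  have hs (n : ℕ) : s (n + 1) = h (s n) := Function.iterate_succ_apply' h n y
  have hidem (n : ℕ) : ∃ z, s n * s n - s n = π ^ (n + 1) • z := by
    induction n with
    | zero => simpa [s] using hy
    | succ n ih =>
      obtain ⟨z, hz⟩ := ih
      refine ⟨π ^ n • (z * (z * (4 * s n ^ 2 - 4 * s n - 3))), ?_⟩
      rw [hs, hh, hz, smul_smul, smul_mul_assoc, smul_mul_assoc, mul_smul_comm, smul_smul]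
      ring_nf
  have hstep (n : ℕ) : ∃ z, s (n + 1) - s n = π ^ (n + 1) • z := by
    obtain ⟨z, hz⟩ := hidem n
    exact ⟨z * (1 - 2 * s n), by rw [hs, hsub, hz, smul_mul_assoc]⟩
  have hadd (m k : ℕ) : ∃ z, s (m + k) - s m = π ^ (m + 1) • z := by
    induction k with
    | zero => exact ⟨0, by simp⟩
    | succ k ih =>
      obtain ⟨z, hz⟩ := ih
      obtain ⟨w, hw⟩ := hstep (m + k)
      refine ⟨π ^ k • w + z, ?_⟩
      rw [← add_assoc, ← sub_add_sub_cancel _ (s (m + k)), hz, hw, smul_add, smul_smul]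
      ring_nf
  obtain ⟨L, hL⟩ := IsPrecomplete.prec (I := Ideal.span {π}) inferInstance (f := s)
    (fun {m n} hmn => by
      obtain ⟨k, rfl⟩ := Nat.exists_eq_add_of_le hmn
      obtain ⟨z, hz⟩ := hadd m k
      refine (SModEq.sub_mem.mpr ((hmem _ _).mpr ⟨π • z, ?_⟩)).symm
      rw [hz, smul_smul, pow_succ])
  have hL' (n : ℕ) : ∃ z, L - s n = π ^ n • z :=
    (hmem _ _).mp (SModEq.sub_mem.mp (hL n).symm)
  refine ⟨L, ?_, ?_⟩
  · refine sub_eq_zero.mp (IsHausdorff.haus (I := Ideal.span {π}) inferInstance _ fun n => ?_)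
    refine SModEq.zero.mpr ((hmem _ _).mpr ?_)
    obtain ⟨z, hz⟩ := hL' n
    obtain ⟨w, hw⟩ := hidem n
    refine ⟨z * L + s n * z - z + π • w, ?_⟩
    have : L * L - L = (L - s n) * L + s n * (L - s n) - (L - s n) + (s n * s n - s n) := by
      noncomm_ring
    rw [this, hz, hw, smul_add, smul_sub, smul_add, smul_mul_assoc, mul_smul_comm, smul_smul,
      pow_succ]
  · obtain ⟨z, hz⟩ := hL' 1
    obtain ⟨w, hw⟩ := hstep 0
    refine ⟨z + w, ?_⟩
    rw [smul_add, ← pow_one π, ← hz, ← zero_add 1, ← hw, sub_add_sub_cancel]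
    rfl

theorem MonoidAlgebra.isAdicComplete_span_singleton {A G : Type*} [CommRing A] [Finite G] (π : A)
    [IsAdicComplete (Ideal.span {π}) A] :
    IsAdicComplete (Ideal.span {π}) (MonoidAlgebra A G) := by
  cases nonempty_fintype G
  have hmemA (n : ℕ) (x : A) :
      x ∈ (Ideal.span {π} ^ n • ⊤ : Submodule A A) ↔ ∃ z, x = π ^ n • z := by
    rw [Ideal.span_singleton_pow, Submodule.ideal_span_singleton_smul,
      Submodule.mem_smul_pointwise_iff_exists]
    simp [eq_comm]
  have hmem (n : ℕ) (x : MonoidAlgebra A G) :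
      x ∈ (Ideal.span {π} ^ n • ⊤ : Submodule A (MonoidAlgebra A G)) ↔
        ∀ g, x.coeff g ∈ (Ideal.span {π} ^ n • ⊤ : Submodule A A) := by
    rw [Ideal.span_singleton_pow, Submodule.ideal_span_singleton_smul,
      Submodule.mem_smul_pointwise_iff_exists]
    simp_rw [← Ideal.span_singleton_pow, hmemA]
    constructor
    · rintro ⟨z, -, rfl⟩ g
      exact ⟨z.coeff g, rfl⟩
    · intro hx
      choose z hz using hx
      refine ⟨ofCoeff (Finsupp.equivFunOnFinite.symm z), trivial, ?_⟩
      ext g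
      simp [hz g]
  refine { haus' := fun x hx => ?_, prec' := fun f hf => ?_ }
  · ext g
    refine IsHausdorff.haus (I := Ideal.span {π}) inferInstance _ fun n => ?_
    exact SModEq.zero.mpr ((hmem n x).mp (SModEq.zero.mp (hx n)) g)
  · have (g : G) := IsPrecomplete.prec (I := Ideal.span {π}) inferInstance
      (f := fun n => (f n).coeff g) fun {m n} hmn =>
        SModEq.sub_mem.mpr ((hmem m _).mp (SModEq.sub_mem.mp (hf hmn)) g)
    choose L hL using this
    refine ⟨ofCoeff (Finsupp.equivFunOnFinite.symm L), fun n => ?_⟩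
    refine SModEq.sub_mem.mpr ((hmem n _).mpr fun g => ?_)
    exact SModEq.sub_mem.mp (hL g n)

namespace MonoidAlgebra

theorem exists_isIdempotentElem_mapRingHom_eq {A k G : Type*} [CommRing A] [CommRing k] [Group G]
    [Finite G] (π : A) [IsAdicComplete (Ideal.span {π}) A] (f : A →+* k)
    (hf : Function.Surjective f) (hker : RingHom.ker f = Ideal.span {π}) {e : MonoidAlgebra k G}
    (he : IsIdempotentElem e) :
    ∃ ε : MonoidAlgebra A G, IsIdempotentElem ε ∧ mapRingHom G f ε = e := by
  have := isAdicComplete_span_singleton (G := G) π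
  have hπ : f π = 0 := RingHom.mem_ker.mp (hker ▸ Ideal.mem_span_singleton_self π)
  have hsmul (z : MonoidAlgebra A G) : mapRingHom G f (π • z) = 0 := by
    ext g
    simp [hπ]
  obtain ⟨y, rfl⟩ := mapRingHom_surjective hf e
  obtain ⟨ε, hε, z, hz⟩ := exists_isIdempotentElem_sub_eq_smul π y (by
    have h₀ : mapRingHom G f (y * y - y) = 0 := by rw [map_sub, map_mul, he.eq, sub_self]
    have (g : G) : ∃ a, (y * y - y).coeff g = π * a := by
      have hg : (y * y - y).coeff g ∈ RingHom.ker f := by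
        rw [RingHom.mem_ker, ← coeff_mapRingHom, h₀]
        rfl
      exact Ideal.mem_span_singleton.mp (hker ▸ hg)
    choose a ha using this
    refine ⟨ofCoeff (Finsupp.equivFunOnFinite.symm a), ?_⟩
    ext g
    simpa using ha g)
  exact ⟨ε, hε, sub_eq_zero.mp (by rw [← map_sub, hz, hsmul])⟩

variable {A k G : Type*} [CommRing A] [IsLocalRing A] [Field k] [Finite k] [Group G] [Finite G]

instance : Finite (MonoidAlgebra k G) := .of_injective _ (DFunLike.coe_injective.comp coeff_injective)

theorem finite_quotient_jacobson {f : A →+* k} (hf : Function.Surjective f) :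
    Finite (MonoidAlgebra A G ⧸ Ring.jacobson (MonoidAlgebra A G)) := by
  let ψ := RingHom.liftOfSurjective (mapRingHom G f) (mapRingHom_surjective hf)
    ⟨Ideal.Quotient.mk (Ring.jacobson (MonoidAlgebra A G)),
      by rw [Ideal.mk_ker]; exact ker_mapRingHom_le_jacobson f⟩
  refine Finite.of_surjective ψ fun x => ?_
  obtain ⟨x, rfl⟩ := Ideal.Quotient.mk_surjective x
  exact ⟨mapRingHom G f x, RingHom.liftOfRightInverse_comp_apply _ _ _ _ _⟩

theorem exists_isIdempotentElem_mk_jacobson_eq {C : Type*} [CommRing C] (π : C)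
    [IsAdicComplete (Ideal.span {π}) C] (j : C →+* A) (f : A →+* k)
    (hf : Function.Surjective (f.comp j)) (hker : RingHom.ker (f.comp j) = Ideal.span {π})
    (e : MonoidAlgebra A G ⧸ Ring.jacobson (MonoidAlgebra A G)) (he : IsIdempotentElem e) :
    ∃ ε : MonoidAlgebra A G, IsIdempotentElem ε ∧ Ideal.Quotient.mk _ ε = e := by
  have hf' : Function.Surjective (mapRingHom G f) :=
    mapRingHom_surjective (.of_comp (g := j) (by simpa using hf))
  let ψ := RingHom.liftOfSurjective (mapRingHom G f) hf'
    ⟨Ideal.Quotient.mk (Ring.jacobson (MonoidAlgebra A G)),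
      by rw [Ideal.mk_ker]; exact ker_mapRingHom_le_jacobson f⟩
  have hψ (x : MonoidAlgebra A G) : ψ (mapRingHom G f x) = Ideal.Quotient.mk _ x :=
    RingHom.liftOfRightInverse_comp_apply _ _ _ _ _
  have hnil (x : MonoidAlgebra k G) (hx : x ∈ RingHom.ker ψ) : IsNilpotent x := by
    obtain ⟨x, rfl⟩ := hf' x
    rw [RingHom.mem_ker, hψ, Ideal.Quotient.eq_zero_iff_mem] at hx
    obtain ⟨n, hn⟩ := IsSemiprimaryRing.isNilpotent (R := MonoidAlgebra k G)
    refine ⟨n, ?_⟩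
    have : RingHomSurjective (mapRingHom G f) := ⟨hf'⟩
    have hx' : mapRingHom G f x ∈ Ring.jacobson (MonoidAlgebra k G) :=
      Ring.le_comap_jacobson (mapRingHom G f) hx
    have := Ideal.pow_mem_pow hx' n
    rw [hn] at this
    simpa using this
  obtain ⟨e', he', rfl⟩ := exists_isIdempotentElem_eq_of_ker_isNilpotent ψ hnil e (by
    obtain ⟨x, rfl⟩ := Ideal.Quotient.mk_surjective e
    exact ⟨_, hψ x⟩) he
  obtain ⟨ε, hε, rfl⟩ := exists_isIdempotentElem_mapRingHom_eq π (f.comp j) hf hker he'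
  refine ⟨mapRingHom G j ε, hε.map _, ?_⟩
  rw [← hψ, mapRingHom_comp]
  rfl

end MonoidAlgebra

section Torsion

variable {A R : Type*} [CommRing A] [Ring R] [Algebra A R]

theorem exists_algebraMap_smul_eq_zero [NoZeroDivisors A] [Nontrivial A] {P : Type*}
    [AddCommGroup P] [Module R P] [hP : Module.Finite R P]
    (htors : ∀ x : P, ∃ s : A, s ≠ 0 ∧ algebraMap A R s • x = 0) :
    ∃ s : A, s ≠ 0 ∧ ∀ x : P, algebraMap A R s • x = 0 := by
  obtain ⟨S, hS⟩ := hP.fg_top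
  choose s hs hsx using htors
  refine ⟨∏ x ∈ S, s x, Finset.prod_ne_zero_iff.mpr fun x _ => hs x, fun x => ?_⟩
  induction hS ▸ Submodule.mem_top (x := x) using Submodule.span_induction with
  | mem x hx =>
    obtain ⟨t, ht⟩ := Finset.dvd_prod_of_mem s (Finset.mem_coe.mp hx)
    rw [ht, mul_comm, map_mul, mul_smul, hsx, smul_zero]
  | zero => exact smul_zero _
  | add x y _ _ hx hy => rw [smul_add, hx, hy, add_zero]
  | smul r x _ hx => rw [smul_smul, Algebra.commutes, mul_smul, hx, smul_zero]

theorem Submodule.finite_of_projective_of_algebraMap_smul_mem {κ : Type*} [Fintype κ]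
    (Q : Submodule R (κ → R)) [Module.Projective R Q] {s : A}
    (hs : ∀ r : R, algebraMap A R s * r = 0 → r = 0)
    (hQ : ∀ v : κ → R, algebraMap A R s • v ∈ Q) : Module.Finite R Q := by
  classical
  obtain ⟨l, hl⟩ := Module.projective_def'.mp ‹Module.Projective R Q›
  let b (i : κ) : Q := ⟨algebraMap A R s • Pi.single i 1, hQ _⟩
  refine ⟨⟨Finset.univ.biUnion fun i => (l (b i)).support, eq_top_iff.mpr fun v _ => ?_⟩⟩
  have hv : algebraMap A R s • v = ∑ i, v.1 i • b i := by
    ext j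
    simp [b, Finset.sum_apply, Pi.single_apply]
  have hsupp : (l v).support ⊆ Finset.univ.biUnion fun i => (l (b i)).support := by
    intro q hq
    by_contra hnot
    simp only [Finset.mem_biUnion, Finset.mem_univ, true_and, not_exists,
      Finsupp.notMem_support_iff] at hnot
    refine Finsupp.mem_support_iff.mp hq (hs _ ?_)
    have := congrArg (fun w => l w q) hv
    simpa [Finsupp.finsetSum_apply, hnot, ← Algebra.smul_def] using this
  rw [← LinearMap.id_apply (R := R) v, ← hl]
  exact Submodule.sum_mem _ fun q hq =>
    Submodule.smul_mem _ _ (Submodule.subset_span (Finset.mem_coe.mpr (hsupp hq)))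

theorem Module.exists_sum_smul_eq (R M : Type*) [Ring R] [AddCommGroup M] [Module R M]
    [Module.Finite R M] [Module.Projective R M] :
    ∃ (n : ℕ) (x : Fin n → M) (φ : Fin n → M →ₗ[R] R), ∀ m, ∑ i, φ i m • x i = m := by
  obtain ⟨n, f, hf⟩ := Module.Finite.exists_fin' R M
  obtain ⟨h, hh⟩ := Module.projective_lifting_property f LinearMap.id hf
  refine ⟨n, fun i => f (Pi.single i 1), fun i => LinearMap.proj i ∘ₗ h, fun m => ?_⟩
  calc ∑ i, h m i • f (Pi.single i 1) = f (∑ i, h m i • Pi.single i 1) := by simp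
    _ = f (h m) := by rw [← pi_eq_sum_univ' (h m)]
    _ = m := LinearMap.congr_fun hh m

theorem algebraMap_mul_sum_dualBasis_sub_mem {κ ι : Type*} [Fintype κ] [Fintype ι] [DecidableEq κ]
    (Q : Submodule R (κ → R)) {s : A} (hQ : ∀ v : κ → R, algebraMap A R s • v ∈ Q)
    (x : ι → Q) (φ : ι → Q →ₗ[R] R) (hx : ∀ m, ∑ i, φ i m • x i = m) :
    algebraMap A R s * (∑ i, φ i (x i) -
      ∑ j, LinearMap.proj (R := R) (φ := fun _ : κ => R) j (Pi.single j 1)) ∈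
        addCommutators R := by
  let g : (κ → R) →ₗ[R] Q :=
    { toFun := fun v => ⟨algebraMap A R s • v, hQ v⟩
      map_add' := fun v w => Subtype.ext (smul_add _ v w)
      map_smul' := fun r v => Subtype.ext <| by
        change algebraMap A R s • r • v = r • algebraMap A R s • v
        rw [smul_smul, Algebra.commutes, mul_smul] }
  have key := sum_tracial_dualBasis_comm (QuotientAddGroup.mk' (addCommutators R))
    (fun a b => by
      rw [← sub_eq_zero, ← map_sub]
      exact (QuotientAddGroup.eq_zero_iff _).mpr (mul_sub_mul_mem_addCommutators a b))
    x φ hx (fun j => Pi.single j (1 : R)) (fun j => LinearMap.proj j)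
    (fun v => (pi_eq_sum_univ' v).symm) Q.subtype g
  rw [← map_sum, ← map_sum, ← sub_eq_zero, ← map_sub] at key
  have hmem := (QuotientAddGroup.eq_zero_iff _).mp key
  have hg (i : ι) : g (Q.subtype (x i)) = algebraMap A R s • x i := rfl
  have hg' (j : κ) : Q.subtype (g (Pi.single j 1)) = algebraMap A R s • Pi.single j 1 := rfl
  simp only [hg, hg', map_smul, smul_eq_mul] at hmem
  rwa [← Finset.mul_sum, ← Finset.mul_sum, ← mul_sub] at hmem

end Torsion

theorem MonoidAlgebra.nonempty_ker_linearEquiv {C A k G P : Type*} [CommRing A] [IsLocalRing A]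
    [NoZeroDivisors A] [Field k] [Finite k] [Group G] [Finite G] [CommRing C] (π : C)
    [IsAdicComplete (Ideal.span {π}) C] (j : C →+* A) (f : A →+* k)
    (hf : Function.Surjective (f.comp j)) (hker : RingHom.ker (f.comp j) = Ideal.span {π})
    (p : ℕ) [Fact p.Prime] (hpA : (p : A) ≠ 0) (hpk : (p : k) = 0)
    [AddCommGroup P] [Module (MonoidAlgebra A G) P]
    (htors : ∀ x : P, ∃ s : A, s ≠ 0 ∧ algebraMap A (MonoidAlgebra A G) s • x = 0)
    {κ : Type*} [Finite κ] (q : (κ → MonoidAlgebra A G) →ₗ[MonoidAlgebra A G] P)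
    (hq : Function.Surjective q) [Module.Projective (MonoidAlgebra A G) (LinearMap.ker q)] :
    Nonempty (LinearMap.ker q ≃ₗ[MonoidAlgebra A G] (κ → MonoidAlgebra A G)) := by
  classical
  cases nonempty_fintype κ
  have : Module.Finite (MonoidAlgebra A G) P := .of_surjective q hq
  obtain ⟨s, hs, hsP⟩ := exists_algebraMap_smul_eq_zero htors
  have hQ (v : κ → MonoidAlgebra A G) :
      algebraMap A (MonoidAlgebra A G) s • v ∈ LinearMap.ker q := by
    rw [LinearMap.mem_ker, map_smul, hsP]
  have hreg (r : MonoidAlgebra A G) (hr : algebraMap A (MonoidAlgebra A G) s * r = 0) : r = 0 := by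
    rw [← Algebra.smul_def] at hr
    ext g
    simpa [hs] using congrArg (fun w => w.coeff g) hr
  have := Submodule.finite_of_projective_of_algebraMap_smul_mem (LinearMap.ker q) hreg hQ
  obtain ⟨n, x, φ, hx⟩ := Module.exists_sum_smul_eq (MonoidAlgebra A G) (LinearMap.ker q)
  have hmem := algebraMap_mul_sum_dualBasis_sub_mem (LinearMap.ker q) hQ x φ hx
  rw [← Algebra.smul_def] at hmem
  have := finite_quotient_jacobson (G := G) (f := f) (.of_comp (g := j) (by simpa using hf))
  have hp : (p : MonoidAlgebra A G) ∈ Ring.jacobson (MonoidAlgebra A G) :=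
    ker_mapRingHom_le_jacobson f (by
      rw [RingHom.mem_ker, map_natCast, ← map_natCast (algebraMap k (MonoidAlgebra k G)), hpk,
        map_zero])
  exact nonempty_linearEquiv_of_sum_dualBasis_sub_mem
    (exists_isIdempotentElem_mk_jacobson_eq π j f hf hker) p hp
    (fun z hz => mem_addCommutators_of_smul_mem hpA (by rwa [Nat.cast_smul_eq_nsmul]))
    x φ hx (fun i => Pi.single i 1) (fun i => LinearMap.proj i)
    (fun v => (pi_eq_sum_univ' v).symm) (mem_addCommutators_of_smul_mem hs hmem)

/-- Let `Λ = ℤ_p[[T₁, …, T_d]]` (`d ≥ 1`), `Δ` a finite group,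
`R = Λ[Δ]`, and `S = Λ ∖ {0}`.  Every finitely generated `S`-torsion left `R`-module `P`
with `pd_R(P) ≤ 1` admits a quadratic presentation `0 → R^a → R^a → P → 0`. -/
theorem statement19 (p : ℕ) [Fact p.Prime] (d : ℕ) (hd : 1 ≤ d)
    (Δ : Type) [Group Δ] [Fintype Δ]
    (P : Type) [AddCommGroup P] [Module (MonoidAlgebra (PSL p d) Δ) P]
    (hfg : Module.Finite (MonoidAlgebra (PSL p d) Δ) P)
    (htors : ∀ x : P, ∃ f : PSL p d, f ≠ 0 ∧
      (MonoidAlgebra.singleOneRingHom f : MonoidAlgebra (PSL p d) Δ) • x = 0)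
    (hpd : PdLE (MonoidAlgebra (PSL p d) Δ) 1 P) :
    ∃ (a : ℕ)
      (g : (Fin a → MonoidAlgebra (PSL p d) Δ)
        →ₗ[MonoidAlgebra (PSL p d) Δ] (Fin a → MonoidAlgebra (PSL p d) Δ))
      (q : (Fin a → MonoidAlgebra (PSL p d) Δ) →ₗ[MonoidAlgebra (PSL p d) Δ] P),
      Function.Injective g ∧ Function.Surjective q ∧ Function.Exact g q := by
  obtain ⟨a, q, hq, hproj⟩ := hpd
  have : Module.Projective (MonoidAlgebra (PSL p d) Δ) (LinearMap.ker q) := hproj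
  let f : PSL p d →+* ZMod p := PadicInt.toZMod.comp MvPowerSeries.constantCoeff
  have hfC : f.comp MvPowerSeries.C = PadicInt.toZMod (p := p) := by
    ext x
    simp [f]
  have hfC_surj : Function.Surjective (f.comp MvPowerSeries.C) := by
    rw [hfC]
    exact ZMod.ringHom_surjective _
  have : IsAdicComplete (Ideal.span {(p : ℤ_[p])}) ℤ_[p] := by
    rw [← PadicInt.maximalIdeal_eq_span_p]
    infer_instance
  have hpA : (p : PSL p d) ≠ 0 := by
    rw [← map_natCast (MvPowerSeries.C (σ := Fin d) (R := ℤ_[p]))]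
    intro h
    have := congrArg MvPowerSeries.constantCoeff h
    simp [(Fact.out : p.Prime).ne_zero] at this
  obtain ⟨e⟩ := MonoidAlgebra.nonempty_ker_linearEquiv (G := Δ) (p : ℤ_[p]) MvPowerSeries.C f
    hfC_surj (by rw [hfC, PadicInt.ker_toZMod, PadicInt.maximalIdeal_eq_span_p]) p hpA
    (CharP.cast_eq_zero _ p) htors q hq
  refine ⟨a, (LinearMap.ker q).subtype ∘ₗ e.symm.toLinearMap, q,
    Subtype.val_injective.comp e.symm.injective, hq, fun v => ⟨fun hv => ?_, ?_⟩⟩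
  · exact ⟨e ⟨v, hv⟩, by simp⟩
  · rintro ⟨w, rfl⟩
    exact (e.symm w).2
end
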